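/- The category ⟨∘⊗•⟩ consists exactly of the noncrossing two-colored partitions p such that, when p is rotated to a partition with no upper points: (i) all blocks have size one or two; (ii) every block of size two connects a white point and a black point; (iii) between the two legs of every block of size two, the number of white singletons equals the number of black singletons, and the total number of white singletons of p equals the total number of black singletons of p. -/

import Mathlib

noncomputable section
namespace CTCP

/-- Colors of points: `true` = white (∘), `false` = black (•). -/
abbrev Color := Bool

def white : Color := true
def black : Color := false

/-- A two-colored partition with `k` upper and `l` lower points.  The block
structure is recorded as a setoid on the disjoint union of the points. -/
structure TCP where
  k : ℕ
  l : ℕ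
  upColor : Fin k → Color
  lowColor : Fin l → Color
  rel : Setoid (Fin k ⊕ Fin l)

/-- The disjoint union of two equivalence relations. -/
def sumRel {α β : Type*} (r : Setoid α) (s : Setoid β) : (α ⊕ β) → (α ⊕ β) → Prop
  | .inl a, .inl b => r.r a b
  | .inr a, .inr b => s.r a b
  | _, _ => False

def sumSetoid {α β : Type*} (r : Setoid α) (s : Setoid β) : Setoid (α ⊕ β) where
  r := sumRel r s
  iseqv := by
    constructor
    · rintro (a | a)
      · exact r.iseqv.refl a
      · exact s.iseqv.refl a
    · rintro (a | a) (b | b) h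
      · exact r.iseqv.symm h
      · exact h.elim
      · exact h.elim
      · exact s.iseqv.symm h
    · rintro (a | a) (b | b) (c | c) h₁ h₂
      all_goals first
        | exact r.iseqv.trans h₁ h₂
        | exact s.iseqv.trans h₁ h₂
        | exact h₁.elim
        | exact h₂.elim

def splitPt (p q : TCP) :
    (Fin (p.k + q.k) ⊕ Fin (p.l + q.l)) → ((Fin p.k ⊕ Fin p.l) ⊕ (Fin q.k ⊕ Fin q.l))
  | .inl i => (finSumFinEquiv.symm i).elim (fun a => .inl (.inl a)) (fun b => .inr (.inl b))
  | .inr j => (finSumFinEquiv.symm j).elim (fun a => .inl (.inr a)) (fun b => .inr (.inr b))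

/-- Tensor product (horizontal concatenation) of two-colored partitions. -/
def tensor (p q : TCP) : TCP where
  k := p.k + q.k
  l := p.l + q.l
  upColor := fun i => (finSumFinEquiv.symm i).elim p.upColor q.upColor
  lowColor := fun j => (finSumFinEquiv.symm j).elim p.lowColor q.lowColor
  rel := Setoid.comap (splitPt p q) (sumSetoid p.rel q.rel)

def compEmbMid (q p : TCP) (h : q.l = p.k) :
    (Fin p.k ⊕ Fin p.l) → ((Fin q.k ⊕ Fin q.l) ⊕ Fin p.l)
  | .inl i => .inl (.inr (Fin.cast h.symm i))
  | .inr j => .inr j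

/-- The relation generating the blocks of the composition of `q` and `p`:
the blocks of `q` together with the blocks of `p`, glued along the middle row. -/
def compRel (q p : TCP) (h : q.l = p.k) :
    ((Fin q.k ⊕ Fin q.l) ⊕ Fin p.l) → ((Fin q.k ⊕ Fin q.l) ⊕ Fin p.l) → Prop :=
  fun t t' =>
    (∃ x y, q.rel.r x y ∧ t = .inl x ∧ t' = .inl y) ∨
    (∃ x y, p.rel.r x y ∧ t = compEmbMid q p h x ∧ t' = compEmbMid q p h y)

/-- Composition (vertical concatenation) of `q ∈ P(k,l)` with `p ∈ P(l,m)`: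
blocks are joined through the middle points, which are then deleted. -/
def comp (q p : TCP) (h : q.l = p.k) : TCP where
  k := q.k
  l := p.l
  upColor := q.upColor
  lowColor := p.lowColor
  rel := Setoid.comap
    (Sum.elim (fun i : Fin q.k => (Sum.inl (Sum.inl i) : (Fin q.k ⊕ Fin q.l) ⊕ Fin p.l))
      (fun j : Fin p.l => Sum.inr j))
    (Relation.EqvGen.setoid (compRel q p h))

/-- The colors of the lower row of `q` match the colors of the upper row of `p`. -/
def ColorsMatch (q p : TCP) (h : q.l = p.k) : Prop :=
  ∀ j : Fin q.l, q.lowColor j = p.upColor (Fin.cast h j)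

/-- Involution: reflection at the horizontal axis. -/
def invol (p : TCP) : TCP where
  k := p.l
  l := p.k
  upColor := p.lowColor
  lowColor := p.upColor
  rel := Setoid.comap Sum.swap p.rel

/-- Vertical reflection: reflection at the vertical axis. -/
def vref (p : TCP) : TCP where
  k := p.k
  l := p.l
  upColor := fun i => p.upColor i.rev
  lowColor := fun j => p.lowColor j.rev
  rel := Setoid.comap (Sum.map Fin.rev Fin.rev) p.rel

/-- Inversion of colors. -/
def cinv (p : TCP) : TCP where
  k := p.k
  l := p.l
  upColor := fun i => !(p.upColor i)
  lowColor := fun j => !(p.lowColor j)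
  rel := p.rel

/-- Verticolor reflection `p̃`: vertical reflection combined with color inversion. -/
def vcref (p : TCP) : TCP := cinv (vref p)

/-- Rotation of the leftmost upper point to the left end of the lower row
(inverting its color). -/
def rotULdown (p : TCP) (h : 0 < p.k) : TCP where
  k := p.k - 1
  l := p.l + 1
  upColor := fun i => p.upColor ⟨i.1 + 1, by have := i.2; omega⟩
  lowColor := fun j =>
    if hj : j.1 = 0 then !(p.upColor ⟨0, h⟩)
    else p.lowColor ⟨j.1 - 1, by have := j.2; omega⟩
  rel := Setoid.comap
    (Sum.elim
      (fun i : Fin (p.k - 1) => (Sum.inl ⟨i.1 + 1, by have := i.2; omega⟩ : Fin p.k ⊕ Fin p.l))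
      (fun j : Fin (p.l + 1) =>
        if hj : j.1 = 0 then Sum.inl ⟨0, h⟩
        else Sum.inr ⟨j.1 - 1, by have := j.2; omega⟩))
    p.rel

/-- Rotation of the rightmost upper point to the right end of the lower row
(inverting its color). -/
def rotURdown (p : TCP) (h : 0 < p.k) : TCP where
  k := p.k - 1
  l := p.l + 1
  upColor := fun i => p.upColor ⟨i.1, by have := i.2; omega⟩
  lowColor := fun j =>
    if hj : j.1 < p.l then p.lowColor ⟨j.1, hj⟩
    else !(p.upColor ⟨p.k - 1, by omega⟩)
  rel := Setoid.comap
    (Sum.elim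
      (fun i : Fin (p.k - 1) => (Sum.inl ⟨i.1, by have := i.2; omega⟩ : Fin p.k ⊕ Fin p.l))
      (fun j : Fin (p.l + 1) =>
        if hj : j.1 < p.l then Sum.inr ⟨j.1, hj⟩
        else Sum.inl ⟨p.k - 1, by omega⟩))
    p.rel

/-- Rotation of the leftmost lower point to the left end of the upper row
(inverting its color). -/
def rotULup (p : TCP) (h : 0 < p.l) : TCP where
  k := p.k + 1
  l := p.l - 1
  upColor := fun i =>
    if hi : i.1 = 0 then !(p.lowColor ⟨0, h⟩)
    else p.upColor ⟨i.1 - 1, by have := i.2; omega⟩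
  lowColor := fun j => p.lowColor ⟨j.1 + 1, by have := j.2; omega⟩
  rel := Setoid.comap
    (Sum.elim
      (fun i : Fin (p.k + 1) =>
        if hi : i.1 = 0 then (Sum.inr ⟨0, h⟩ : Fin p.k ⊕ Fin p.l)
        else Sum.inl ⟨i.1 - 1, by have := i.2; omega⟩)
      (fun j : Fin (p.l - 1) => Sum.inr ⟨j.1 + 1, by have := j.2; omega⟩))
    p.rel

/-- Rotation of the rightmost lower point to the right end of the upper row
(inverting its color). -/
def rotURup (p : TCP) (h : 0 < p.l) : TCP where
  k := p.k + 1
  l := p.l - 1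
  upColor := fun i =>
    if hi : i.1 < p.k then p.upColor ⟨i.1, hi⟩
    else !(p.lowColor ⟨p.l - 1, by omega⟩)
  lowColor := fun j => p.lowColor ⟨j.1, by have := j.2; omega⟩
  rel := Setoid.comap
    (Sum.elim
      (fun i : Fin (p.k + 1) =>
        if hi : i.1 < p.k then (Sum.inl ⟨i.1, hi⟩ : Fin p.k ⊕ Fin p.l)
        else Sum.inr ⟨p.l - 1, by omega⟩)
      (fun j : Fin (p.l - 1) => Sum.inr ⟨j.1, by have := j.2; omega⟩))
    p.rel

/-- `p'` is obtained from `p` by rotating an outermost point of one row to the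
corresponding end of the other row, inverting its color. -/
def IsRotationOf (p' p : TCP) : Prop :=
  (∃ h : 0 < p.k, p' = rotULdown p h) ∨ (∃ h : 0 < p.k, p' = rotURdown p h) ∨
  (∃ h : 0 < p.l, p' = rotULup p h) ∨ (∃ h : 0 < p.l, p' = rotURup p h)

/-- A partition with no upper points, given by colors and block labels. -/
def mkLower (n : ℕ) (color : Fin n → Color) (lbl : Fin n → ℕ) : TCP where
  k := 0
  l := n
  upColor := Fin.elim0
  lowColor := color
  rel := Setoid.ker (Sum.elim Fin.elim0 lbl)

/-- The identity partition of color `c`. -/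
def idPart (c : Color) : TCP where
  k := 1
  l := 1
  upColor := fun _ => c
  lowColor := fun _ => c
  rel := ⊤

/-- The pair partition on two lower points of colors `c₁`, `c₂`. -/
def pairLower (c₁ c₂ : Color) : TCP := mkLower 2 ![c₁, c₂] (fun _ => 0)

/-- The singleton of color `c`. -/
def singl (c : Color) : TCP := mkLower 1 (fun _ => c) (fun _ => 0)

/-- `bPart s` : one block on `s` white lower points (`bPart 0` is the empty partition). -/
def bPart (s : ℕ) : TCP := mkLower s (fun _ => white) (fun _ => 0)

/-- One block on four lower points with the given colors. -/
def fourBlock (c₁ c₂ c₃ c₄ : Color) : TCP := mkLower 4 ![c₁, c₂, c₃, c₄] (fun _ => 0)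

/-- The four-block ∘•∘•. -/
def fourWBWB : TCP := fourBlock white black white black

/-- The four-block ∘∘••. -/
def fourWWBB : TCP := fourBlock white white black black

/-- The empty partition. -/
def emptyPart : TCP := mkLower 0 Fin.elim0 Fin.elim0

/-- The partition ∘⊗• (a white and a black singleton). -/
def singPair : TCP := tensor (singl white) (singl black)

/-- The partition ∘∘⊗••. -/
def wwbb : TCP := tensor (pairLower white white) (pairLower black black)

/-- The crossing partition `X` on four white points: first upper point connected to the
second lower point, second upper point connected to the first lower point. -/
def crossPart : TCP where
  k := 2
  l := 2
  upColor := fun _ => white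
  lowColor := fun _ => white
  rel := Setoid.ker (Sum.elim (fun i : Fin 2 => (i.1 : ℕ)) (fun j : Fin 2 => 1 - j.1))

/-- `n`-fold tensor power. -/
def tensorPow (p : TCP) : ℕ → TCP
  | 0 => emptyPart
  | n + 1 => tensor (tensorPow p n) p

/-- The partition `p_d`: from left to right, `d` white singletons, a white point, `d` black
singletons and a black point, the two non-singleton points forming a pair block. -/
def pPart (d : ℕ) : TCP :=
  mkLower (2 * d + 2) (fun j => decide (j.1 ≤ d))
    (fun j => if j.1 = d ∨ j.1 = 2 * d + 1 then 0 else j.1 + 1)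

/-- The partition `p′_r`: from left to right, `r+1` white singletons, a black point, `r−1`
black singletons and a black point, the black non-singleton points forming a pair block;
for `r = 0` the middle consists of one white singleton instead. -/
def pPrime (r : ℕ) : TCP :=
  if r = 0 then
    mkLower 4 ![white, black, white, black]
      (fun j => if j.1 = 1 ∨ j.1 = 3 then 0 else j.1 + 1)
  else
    mkLower (2 * r + 2) (fun j => decide (j.1 ≤ r))
      (fun j => if j.1 = r + 1 ∨ j.1 = 2 * r + 1 then 0 else j.1 + 1)

/-- A category of two-colored partitions: a class of two-colored partitions closed under
tensor products, composition (when defined) and involution, containing both bicolored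
pair partitions and both identity partitions. -/
structure IsCategory (C : Set TCP) : Prop where
  tensor_mem : ∀ p ∈ C, ∀ q ∈ C, tensor p q ∈ C
  comp_mem : ∀ q ∈ C, ∀ p ∈ C, ∀ h : q.l = p.k, ColorsMatch q p h → comp q p h ∈ C
  invol_mem : ∀ p ∈ C, invol p ∈ C
  idw_mem : idPart white ∈ C
  idb_mem : idPart black ∈ C
  pairwb_mem : pairLower white black ∈ C
  pairbw_mem : pairLower black white ∈ C

/-- The smallest category of partitions containing `S`. -/
def generated (S : Set TCP) : Set TCP :=
  {p | ∀ C : Set TCP, IsCategory C → S ⊆ C → p ∈ C}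

/-- `c(p)` : (white lower points + black upper points) − (black lower points + white upper
points). -/
def cval (p : TCP) : ℤ :=
  ((Nat.card {j : Fin p.l // p.lowColor j = white} +
      Nat.card {i : Fin p.k // p.upColor i = black} : ℕ) : ℤ) -
    ((Nat.card {j : Fin p.l // p.lowColor j = black} +
      Nat.card {i : Fin p.k // p.upColor i = white} : ℕ) : ℤ)

/-- Position of a point on the line obtained by rotating all upper points down to the
left of the lower row. -/
def linePos (p : TCP) : (Fin p.k ⊕ Fin p.l) → ℕ :=
  Sum.elim (fun i => p.k - 1 - i.1) (fun j => p.k + j.1)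

/-- A partition is noncrossing if its strings can be drawn without crossings. -/
def Noncrossing (p : TCP) : Prop :=
  ∀ a b x y : Fin p.k ⊕ Fin p.l,
    linePos p a < linePos p b → linePos p b < linePos p x → linePos p x < linePos p y →
    p.rel.r a x → p.rel.r b y → p.rel.r a b

/-- The number of points in the block of the point `x`. -/
def blockSize (p : TCP) (x : Fin p.k ⊕ Fin p.l) : ℕ := Nat.card {y // p.rel.r x y}

/-- The partition obtained from `p` by rotating all upper points down, so that it has no
upper points. -/
def toLine (p : TCP) : TCP where
  k := 0
  l := p.k + p.l
  upColor := Fin.elim0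
  lowColor := fun j =>
    if hj : j.1 < p.k then !(p.upColor ⟨p.k - 1 - j.1, by omega⟩)
    else p.lowColor ⟨j.1 - p.k, by have := j.2; omega⟩
  rel := Setoid.comap
    (Sum.elim (fun i : Fin 0 => (Fin.elim0 i : Fin p.k ⊕ Fin p.l))
      (fun j : Fin (p.k + p.l) =>
        if hj : j.1 < p.k then Sum.inl ⟨p.k - 1 - j.1, by omega⟩
        else Sum.inr ⟨j.1 - p.k, by have := j.2; omega⟩))
    p.rel

def eraseLowRel (p : TCP) (j : ℕ) (hj : j + 1 < p.l) :
    (Fin p.k ⊕ Fin p.l) → (Fin p.k ⊕ Fin p.l) → Prop :=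
  fun x y => p.rel.r x y ∨ (x = Sum.inr ⟨j, by omega⟩ ∧ y = Sum.inr ⟨j + 1, hj⟩)

/-- Erasing the `j`-th and `(j+1)`-th lower points of `p`, first joining their blocks. -/
def eraseLowerPair (p : TCP) (j : ℕ) (hj : j + 1 < p.l) : TCP where
  k := p.k
  l := p.l - 2
  upColor := p.upColor
  lowColor := fun m =>
    if hm : m.1 < j then p.lowColor ⟨m.1, by omega⟩
    else p.lowColor ⟨m.1 + 2, by have := m.2; omega⟩
  rel := Setoid.comap
    (Sum.elim (fun i : Fin p.k => (Sum.inl i : Fin p.k ⊕ Fin p.l))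
      (fun m : Fin (p.l - 2) =>
        if hm : m.1 < j then Sum.inr ⟨m.1, by omega⟩
        else Sum.inr ⟨m.1 + 2, by have := m.2; omega⟩))
    (Relation.EqvGen.setoid (eraseLowRel p j hj))

def eraseUpRel (p : TCP) (j : ℕ) (hj : j + 1 < p.k) :
    (Fin p.k ⊕ Fin p.l) → (Fin p.k ⊕ Fin p.l) → Prop :=
  fun x y => p.rel.r x y ∨ (x = Sum.inl ⟨j, by omega⟩ ∧ y = Sum.inl ⟨j + 1, hj⟩)

/-- Erasing the `j`-th and `(j+1)`-th upper points of `p`, first joining their blocks. -/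
def eraseUpperPair (p : TCP) (j : ℕ) (hj : j + 1 < p.k) : TCP where
  k := p.k - 2
  l := p.l
  upColor := fun m =>
    if hm : m.1 < j then p.upColor ⟨m.1, by omega⟩
    else p.upColor ⟨m.1 + 2, by have := m.2; omega⟩
  lowColor := p.lowColor
  rel := Setoid.comap
    (Sum.elim
      (fun m : Fin (p.k - 2) =>
        if hm : m.1 < j then (Sum.inl ⟨m.1, by omega⟩ : Fin p.k ⊕ Fin p.l)
        else Sum.inl ⟨m.1 + 2, by have := m.2; omega⟩)
      (fun i : Fin p.l => Sum.inr i))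
    (Relation.EqvGen.setoid (eraseUpRel p j hj))

/-- `p₁ ⊗ p₂ ∈ C` is in nest decomposed form, with the first point of `p₂` colored `x`
and the last point of `p₂` colored `y` (and those two points in the same block). -/
def InNDF (C : Set TCP) (x y : Color) (p₁ p₂ : TCP) : Prop :=
  tensor p₁ p₂ ∈ C ∧ Noncrossing (tensor p₁ p₂) ∧ p₁.k = 0 ∧ p₂.k = 0 ∧ 0 < p₁.l ∧
    ∃ h : 2 ≤ p₂.l,
      p₂.lowColor ⟨0, by omega⟩ = x ∧ p₂.lowColor ⟨p₂.l - 1, by omega⟩ = y ∧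
      p₂.rel.r (Sum.inr ⟨0, by omega⟩) (Sum.inr ⟨p₂.l - 1, by omega⟩)

/-- `K^C(x,y)`: the set of values `c(p₁)` over nest decomposed forms `p₁ ⊗ p₂ ∈ C` whose
outer block starts with color `x` and ends with color `y`. -/
def Kset (C : Set TCP) (x y : Color) : Set ℤ :=
  {n | ∃ p₁ p₂, InNDF C x y p₁ p₂ ∧ cval p₁ = n}

/-- The degree of reflection `k(C)`. -/
def kdeg (C : Set TCP) : ℕ := sInf {n : ℕ | 0 < n ∧ ∃ p ∈ C, cval p = (n : ℤ)}

/-- The local parameter `d(C)`. -/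
def ddeg (C : Set TCP) : ℕ := sInf {n : ℕ | 0 < n ∧ (n : ℤ) ∈ Kset C white black}

/-- The local parameter `r(C) = min {t ≥ 1 | t ∈ K^C(•,•)} − 1`. -/
def rdeg (C : Set TCP) : ℕ := sInf {t : ℕ | 1 ≤ t ∧ (t : ℤ) ∈ Kset C black black} - 1

/-- `C` is globally colorized if it contains `∘∘ ⊗ ••`. -/
def GloballyColorized (C : Set TCP) : Prop := wwbb ∈ C

def CaseO (C : Set TCP) : Prop := singPair ∉ C ∧ fourWBWB ∉ C
def CaseB (C : Set TCP) : Prop := singPair ∈ C ∧ fourWBWB ∉ C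
def CaseH (C : Set TCP) : Prop := singPair ∉ C ∧ fourWBWB ∈ C
def CaseS (C : Set TCP) : Prop := singPair ∈ C ∧ fourWBWB ∈ C

/-! Non-colored partitions. -/

/-- A non-colored partition with `k` upper and `l` lower points. -/
structure NCP where
  k : ℕ
  l : ℕ
  rel : Setoid (Fin k ⊕ Fin l)

namespace NCP

def splitPt (p q : NCP) :
    (Fin (p.k + q.k) ⊕ Fin (p.l + q.l)) → ((Fin p.k ⊕ Fin p.l) ⊕ (Fin q.k ⊕ Fin q.l))
  | .inl i => (finSumFinEquiv.symm i).elim (fun a => .inl (.inl a)) (fun b => .inr (.inl b))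
  | .inr j => (finSumFinEquiv.symm j).elim (fun a => .inl (.inr a)) (fun b => .inr (.inr b))

def tensor (p q : NCP) : NCP where
  k := p.k + q.k
  l := p.l + q.l
  rel := Setoid.comap (splitPt p q) (sumSetoid p.rel q.rel)

def compEmbMid (q p : NCP) (h : q.l = p.k) :
    (Fin p.k ⊕ Fin p.l) → ((Fin q.k ⊕ Fin q.l) ⊕ Fin p.l)
  | .inl i => .inl (.inr (Fin.cast h.symm i))
  | .inr j => .inr j

def compRel (q p : NCP) (h : q.l = p.k) :
    ((Fin q.k ⊕ Fin q.l) ⊕ Fin p.l) → ((Fin q.k ⊕ Fin q.l) ⊕ Fin p.l) → Prop :=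
  fun t t' =>
    (∃ x y, q.rel.r x y ∧ t = .inl x ∧ t' = .inl y) ∨
    (∃ x y, p.rel.r x y ∧ t = compEmbMid q p h x ∧ t' = compEmbMid q p h y)

def comp (q p : NCP) (h : q.l = p.k) : NCP where
  k := q.k
  l := p.l
  rel := Setoid.comap
    (Sum.elim (fun i : Fin q.k => (Sum.inl (Sum.inl i) : (Fin q.k ⊕ Fin q.l) ⊕ Fin p.l))
      (fun j : Fin p.l => Sum.inr j))
    (Relation.EqvGen.setoid (compRel q p h))

def invol (p : NCP) : NCP where
  k := p.l
  l := p.k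
  rel := Setoid.comap Sum.swap p.rel

/-- The non-colored identity partition. -/
def idN : NCP := ⟨1, 1, ⊤⟩

/-- The non-colored pair partition on two lower points. -/
def pairN : NCP := ⟨0, 2, ⊤⟩

end NCP

/-- A category of non-colored partitions. -/
structure IsCategoryN (D : Set NCP) : Prop where
  tensor_mem : ∀ p ∈ D, ∀ q ∈ D, NCP.tensor p q ∈ D
  comp_mem : ∀ q ∈ D, ∀ p ∈ D, ∀ h : q.l = p.k, NCP.comp q p h ∈ D
  invol_mem : ∀ p ∈ D, NCP.invol p ∈ D
  id_mem : NCP.idN ∈ D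
  pair_mem : NCP.pairN ∈ D

/-- The map `Ψ` forgetting the colors of a two-colored partition. -/
def forget (p : TCP) : NCP := ⟨p.k, p.l, p.rel⟩

/-- A point of a labelled word: its color together with the label of its block. -/
abbrev Letter := Bool × ℕ

/-- The label `x` does not occur in the word `w`. -/
def Fresh (x : ℕ) (w : List Letter) : Prop := ∀ e ∈ w, e.2 ≠ x

@[simp] lemma fresh_nil (x : ℕ) : Fresh x [] := by simp [Fresh]

@[simp] lemma fresh_cons (x : ℕ) (e : Letter) (w : List Letter) :
    Fresh x (e :: w) ↔ e.2 ≠ x ∧ Fresh x w := by simp [Fresh]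

@[simp] lemma fresh_append (x : ℕ) (u v : List Letter) :
    Fresh x (u ++ v) ↔ Fresh x u ∧ Fresh x v := by
  simp [Fresh, or_imp, forall_and]

/-- Relabelling of a letter. -/
def relabel (f : ℕ → ℕ) (e : Letter) : Letter := (e.1, f e.2)

/-- Color inversion of a letter. -/
def inv (e : Letter) : Letter := (!e.1, e.2)

@[simp] lemma relabel_mk (f : ℕ → ℕ) (c : Bool) (x : ℕ) : relabel f (c, x) = (c, f x) := rfl
@[simp] lemma relabel_fst (f : ℕ → ℕ) (e : Letter) : (relabel f e).1 = e.1 := rfl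
@[simp] lemma relabel_snd (f : ℕ → ℕ) (e : Letter) : (relabel f e).2 = f e.2 := rfl
@[simp] lemma inv_mk (c : Bool) (x : ℕ) : inv (c, x) = (!c, x) := rfl
@[simp] lemma inv_comp_inv : inv ∘ inv = id := by ext e <;> simp [inv]

@[simp] lemma fresh_reverse (x : ℕ) (w : List Letter) : Fresh x w.reverse ↔ Fresh x w := by
  simp [Fresh]

@[simp] lemma fresh_map_inv (x : ℕ) (w : List Letter) : Fresh x (w.map inv) ↔ Fresh x w := by
  simp [Fresh, and_comm]

lemma map_relabel_eq_self {f : ℕ → ℕ} {w : List Letter} (h : ∀ e ∈ w, f e.2 = e.2) :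
    w.map (relabel f) = w :=
  (List.map_congr_left (g := id) fun e he => by simp [relabel, h e he]).trans (List.map_id _)

lemma map_relabel_congr {f g : ℕ → ℕ} {w : List Letter} (h : ∀ e ∈ w, f e.2 = g e.2) :
    w.map (relabel f) = w.map (relabel g) :=
  List.map_congr_left fun e he => by simp [relabel, h e he]

lemma map_relabel_map (f g : ℕ → ℕ) (w : List Letter) :
    (w.map (relabel f)).map (relabel g) = w.map (relabel (g ∘ f)) := by
  simp [relabel, Function.comp_def]

/-- Words obtained from the empty word by successively inserting adjacent pair blocks of
different colors and adjacent singletons of different colors. -/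
inductive Good : List Letter → Prop
  | nil : Good []
  | pair (u v : List Letter) (c : Bool) (x : ℕ) :
      Good (u ++ v) → Fresh x (u ++ v) → Good (u ++ (c, x) :: (!c, x) :: v)
  | sing (u v : List Letter) (c : Bool) (x y : ℕ) :
      Good (u ++ v) → Fresh x (u ++ v) → Fresh y (u ++ v) → x ≠ y →
      Good (u ++ (c, x) :: (!c, y) :: v)

/-- Comparing the position of a letter with that of two adjacent letters. -/
lemma insert_two_split {α : Type*} {u v X Y : List α} {a b s : α}
    (h : u ++ a :: b :: v = X ++ s :: Y) :
    (∃ v', v = v' ++ s :: Y ∧ X = u ++ a :: b :: v') ∨ (s = b ∧ Y = v ∧ X = u ++ [a]) ∨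
      (s = a ∧ Y = b :: v ∧ X = u) ∨ (∃ u', u = X ++ s :: u' ∧ Y = u' ++ a :: b :: v) := by
  rcases List.append_eq_append_iff.1 h with ⟨t, rfl, ht⟩ | ⟨t, rfl, ht⟩
  · rcases t with _ | ⟨t1, _ | ⟨t2, t⟩⟩ <;> simp_all
  · rcases t with _ | ⟨t1, t⟩ <;> simp_all

lemma Good.map {w : List Letter} (hw : Good w) (f : ℕ → ℕ)
    (hf : ∀ e ∈ w, ∀ e' ∈ w, f e.2 = f e'.2 → e.2 = e'.2) : Good (w.map (relabel f)) := by
  induction hw with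
  | nil => exact Good.nil
  | pair u v c x h hx ih =>
    have := ih (fun e he e' he' => hf e (by grind) e' (by grind))
    simp only [List.map_append, List.map_cons, relabel_mk] at this ⊢
    refine Good.pair _ _ _ _ this ?_
    rw [← List.map_append]
    intro e he
    obtain ⟨e', he', rfl⟩ := List.mem_map.1 he
    intro h1
    exact hx e' he' (hf e' (by grind) (c, x) (by simp) h1)
  | sing u v c x y h hx hy hxy ih =>
    have := ih (fun e he e' he' => hf e (by grind) e' (by grind))
    simp only [List.map_append, List.map_cons, relabel_mk] at this ⊢
    refine Good.sing _ _ _ _ _ this ?_ ?_ ?_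
    · rw [← List.map_append]
      intro e he
      obtain ⟨e', he', rfl⟩ := List.mem_map.1 he
      intro h1
      exact hx e' he' (hf e' (by grind) (c, x) (by simp) h1)
    · rw [← List.map_append]
      intro e he
      obtain ⟨e', he', rfl⟩ := List.mem_map.1 he
      intro h1
      exact hy e' he' (hf e' (by grind) (!c, y) (by simp) h1)
    · intro h1
      exact hxy (hf (c, x) (by simp) (!c, y) (by simp) h1)

/-- Reading a word backwards and inverting its colors. -/
def flip (w : List Letter) : List Letter := (w.map inv).reverse

@[simp] lemma flip_append (u v : List Letter) : flip (u ++ v) = flip v ++ flip u := by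
  simp [flip]
@[simp] lemma flip_cons (e : Letter) (v : List Letter) : flip (e :: v) = flip v ++ [inv e] := by
  simp [flip]
@[simp] lemma flip_flip (w : List Letter) : flip (flip w) = w := by simp [flip]
@[simp] lemma length_flip (w : List Letter) : (flip w).length = w.length := by simp [flip]
@[simp] lemma fresh_flip (x : ℕ) (w : List Letter) : Fresh x (flip w) ↔ Fresh x w := by
  simp [flip]
lemma map_relabel_flip (f : ℕ → ℕ) (w : List Letter) :
    (flip w).map (relabel f) = flip (w.map (relabel f)) := by
  simp [flip, relabel, inv, Function.comp_def]

lemma Good.flip {w : List Letter} (hw : Good w) : Good (flip w) := by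
  induction hw with
  | nil => exact Good.nil
  | pair u v c x h hx ih =>
    simp only [flip_append, flip_cons, List.append_assoc,
      List.cons_append, List.nil_append, inv_mk, Bool.not_not] at ih ⊢
    exact Good.pair _ _ c x ih (by simpa [and_comm] using hx)
  | sing u v c x y h hx hy hxy ih =>
    simp only [flip_append, flip_cons, List.append_assoc,
      List.cons_append, List.nil_append, inv_mk, Bool.not_not] at ih ⊢
    exact Good.sing _ _ c y x ih (by simpa [and_comm] using hy) (by simpa [and_comm] using hx)
      hxy.symm

lemma Good.insert {X Y w : List Letter} (h : Good (X ++ Y)) (hw : Good w)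
    (hd : ∀ e ∈ w, Fresh e.2 (X ++ Y)) : Good (X ++ w ++ Y) := by
  induction hw with
  | nil => simpa using h
  | pair u v c x h hx ih =>
    have h1 := ih (fun e he => hd e (by grind))
    have h2 : Good ((X ++ u) ++ (v ++ Y)) := by simpa using h1
    have h3 := hd (c, x) (by simp)
    simpa using Good.pair _ _ c x h2 (by simp at hx h3 ⊢; tauto)
  | sing u v c x y h hx hy hxy ih =>
    have h1 := ih (fun e he => hd e (by grind))
    have h2 : Good ((X ++ u) ++ (v ++ Y)) := by simpa using h1
    have h3 := hd (c, x) (by simp)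
    have h4 := hd (!c, y) (by simp)
    simpa using Good.sing _ _ c x y h2 (by simp at hx h3 ⊢; tauto)
      (by simp at hy h4 ⊢; tauto) hxy

/-- Detaching a point from its block preserves goodness. -/
lemma Good.detach {w : List Letter} (hw : Good w) :
    ∀ (X Y : List Letter) (c : Bool) (x z : ℕ), w = X ++ (c, x) :: Y → Fresh z w →
      Good (X ++ (c, z) :: Y) := by
  induction hw with
  | nil => intro X Y c x z h; simp at h
  | pair u v d t h ht ih =>
    intro X Y c x z hw hz
    simp only [fresh_append, fresh_cons] at hz ht
    rcases insert_two_split hw with ⟨v', rfl, rfl⟩ | ⟨hs, rfl, rfl⟩ | ⟨hs, rfl, rfl⟩ | ⟨u', rfl, rfl⟩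
    · have := ih (u ++ v') Y c x z (by simp) (by simp at hz ⊢; tauto)
      simpa using Good.pair u (v' ++ (c, z) :: Y) d t (by simpa using this)
        (by simp at ht hz ⊢; tauto)
    · obtain ⟨rfl, rfl⟩ := Prod.mk.inj hs
      simpa using Good.sing u Y d x z h (by simp; tauto) (by simp; tauto) (by tauto)
    · obtain ⟨rfl, rfl⟩ := Prod.mk.inj hs
      simpa using Good.sing X v c z x h (by simp; tauto) (by simp; tauto) (by tauto)
    · have := ih X (u' ++ v) c x z (by simp) (by simp at hz ⊢; tauto)
      simpa using Good.pair (X ++ (c, z) :: u') v d t (by simpa using this)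
        (by simp at ht hz ⊢; tauto)
  | sing u v d t t' h ht ht' htt ih =>
    intro X Y c x z hw hz
    simp only [fresh_append, fresh_cons] at hz ht ht'
    rcases insert_two_split hw with ⟨v', rfl, rfl⟩ | ⟨hs, rfl, rfl⟩ | ⟨hs, rfl, rfl⟩ | ⟨u', rfl, rfl⟩
    · have := ih (u ++ v') Y c x z (by simp) (by simp at hz ⊢; tauto)
      simpa using Good.sing u (v' ++ (c, z) :: Y) d t t' (by simpa using this)
        (by simp at ht hz ⊢; tauto) (by simp at ht' hz ⊢; tauto) htt
    · obtain ⟨rfl, rfl⟩ := Prod.mk.inj hs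
      simpa using Good.sing u Y d t z h (by simp; tauto) (by simp; tauto) (by tauto)
    · obtain ⟨rfl, rfl⟩ := Prod.mk.inj hs
      simpa using Good.sing X v c z t' h (by simp; tauto) (by simp; tauto) (by tauto)
    · have := ih X (u' ++ v) c x z (by simp) (by simp at hz ⊢; tauto)
      simpa using Good.sing (X ++ (c, z) :: u') v d t t' (by simpa using this)
        (by simp at ht hz ⊢; tauto) (by simp at ht' hz ⊢; tauto) htt

/-- Identifying the label `x` with the label `y`. -/
def subst (x y a : ℕ) : ℕ := if a = x then y else a

lemma fresh_map_subst {x y t : ℕ} {w : List Letter} (hy : y ≠ t) (hw : Fresh t w) :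
    Fresh t (w.map (relabel (subst x y))) := by
  intro e he
  obtain ⟨e', he', rfl⟩ := List.mem_map.1 he
  simp only [relabel_snd, subst]
  split_ifs
  · exact hy
  · exact hw e' he'

lemma map_subst_of_fresh {x y : ℕ} {w : List Letter} (hw : Fresh x w) :
    w.map (relabel (subst x y)) = w :=
  map_relabel_eq_self fun e he => by simp [subst, hw e he]

lemma Good.map_subst {x y : ℕ} {w : List Letter} (h : Good w) (hw : Fresh y w) :
    Good (w.map (relabel (subst x y))) :=
  h.map _ fun e he e' he' => by
    have := hw e he
    have := hw e' he'
    simp only [subst]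
    grind

/-- Joining the blocks of two adjacent points of different colors and erasing the two points
preserves goodness. -/
lemma Good.contract {w : List Letter} (hw : Good w) :
    ∀ (X Y : List Letter) (c : Bool) (x y : ℕ), w = X ++ (c, x) :: (!c, y) :: Y →
      Good ((X ++ Y).map (relabel (subst x y))) := by
  induction hw with
  | nil => intro X Y c x y h; simp at h
  | pair u v d t h ht ih =>
    intro X Y c x y hw
    rcases insert_two_split hw with ⟨v', rfl, rfl⟩ | ⟨hs, rfl, rfl⟩ | ⟨hs, hY, rfl⟩ | ⟨u', rfl, hY⟩
    · have := ih (u ++ v') Y c x y (by simp)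
      have hs : subst x y t = t := by
        simp only [fresh_append, fresh_cons] at ht; simp only [subst]; grind
      simpa [hs] using Good.pair (u.map (relabel (subst x y)))
        ((v' ++ Y).map (relabel (subst x y))) d t (by simpa using this) (by
          rw [← List.map_append]
          exact fresh_map_subst (by simp at ht; tauto) (by simp at ht ⊢; tauto))
    · obtain ⟨rfl, rfl⟩ := Prod.mk.inj hs
      simp only [fresh_append, fresh_cons] at ht
      simpa [map_subst_of_fresh ht.1, map_subst_of_fresh ht.2.2, subst] using h
    · obtain ⟨rfl, rfl⟩ := Prod.mk.inj hs
      obtain ⟨-, rfl⟩ := List.cons.inj hY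
      rwa [map_subst_of_fresh ht]
    · rcases u' with _ | ⟨e, u'⟩
      · obtain ⟨he, rfl⟩ := List.cons.inj hY
        obtain ⟨rfl, rfl⟩ := Prod.mk.inj he
        simpa [subst] using h.map_subst (x := x) ht
      · obtain ⟨rfl, rfl⟩ := List.cons.inj hY
        have := ih X (u' ++ v) c x y (by simp)
        have hs : subst x y t = t := by
          simp only [fresh_append, fresh_cons] at ht; simp only [subst]; grind
        simpa [hs] using Good.pair ((X ++ u').map (relabel (subst x y)))
          (v.map (relabel (subst x y))) d t (by simpa using this) (by
            rw [← List.map_append]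
            exact fresh_map_subst (by simp at ht; tauto) (by simp at ht ⊢; tauto))
  | sing u v d t t' h ht ht' htt ih =>
    intro X Y c x y hw
    rcases insert_two_split hw with ⟨v', rfl, rfl⟩ | ⟨hs, rfl, rfl⟩ | ⟨hs, hY, rfl⟩ | ⟨u', rfl, hY⟩
    · have := ih (u ++ v') Y c x y (by simp)
      have hs : subst x y t = t := by
        simp only [fresh_append, fresh_cons] at ht; simp only [subst]; grind
      have hs' : subst x y t' = t' := by
        simp only [fresh_append, fresh_cons] at ht'; simp only [subst]; grind
      simpa [hs, hs'] using Good.sing (u.map (relabel (subst x y)))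
        ((v' ++ Y).map (relabel (subst x y))) d t t' (by simpa using this) (by
          rw [← List.map_append]
          exact fresh_map_subst (by simp at ht; tauto) (by simp at ht ⊢; tauto)) (by
          rw [← List.map_append]
          exact fresh_map_subst (by simp at ht'; tauto) (by simp at ht' ⊢; tauto)) htt
    · obtain ⟨rfl, rfl⟩ := Prod.mk.inj hs
      have := h.detach u Y d y t (by simp) ht
      rw [map_subst_of_fresh]
      · simpa using this
      · simp only [fresh_append, fresh_cons] at ht' ⊢
        exact ⟨⟨ht'.1, htt, by simp⟩, ht'.2.2⟩
    · obtain ⟨rfl, rfl⟩ := Prod.mk.inj hs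
      obtain ⟨he, rfl⟩ := List.cons.inj hY
      obtain ⟨-, rfl⟩ := Prod.mk.inj he
      rwa [map_subst_of_fresh ht]
    · rcases u' with _ | ⟨e, u'⟩
      · obtain ⟨he, rfl⟩ := List.cons.inj hY
        obtain ⟨rfl, rfl⟩ := Prod.mk.inj he
        have := h.detach X v c x t' (by simp) ht'
        have h2 := this.map_subst (x := x) (y := y) (by
          simp only [fresh_append, fresh_cons] at ht ⊢
          exact ⟨ht.1.1, htt.symm, ht.2⟩)
        simpa using h2
      · obtain ⟨rfl, rfl⟩ := List.cons.inj hY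
        have := ih X (u' ++ v) c x y (by simp)
        have hs : subst x y t = t := by
          simp only [fresh_append, fresh_cons] at ht; simp only [subst]; grind
        have hs' : subst x y t' = t' := by
          simp only [fresh_append, fresh_cons] at ht'; simp only [subst]; grind
        simpa [hs, hs'] using Good.sing ((X ++ u').map (relabel (subst x y)))
          (v.map (relabel (subst x y))) d t t' (by simpa using this) (by
            rw [← List.map_append]
            exact fresh_map_subst (by simp at ht; tauto) (by simp at ht ⊢; tauto)) (by
            rw [← List.map_append]
            exact fresh_map_subst (by simp at ht'; tauto) (by simp at ht' ⊢; tauto)) htt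

/-- The upper copy of a list of colored pairs of labels. -/
def topRow (T : List (Bool × ℕ × ℕ)) : List Letter := T.map fun t => (t.1, t.2.1)

/-- The lower copy of a list of colored pairs of labels. -/
def botRow (T : List (Bool × ℕ × ℕ)) : List Letter := T.map fun t => (t.1, t.2.2)

/-- Joining two labels if they are paired in `T`. -/
def Joined (T : List (Bool × ℕ × ℕ)) (a b : ℕ) : Prop :=
  Relation.EqvGen (fun a b => ∃ c, (c, a, b) ∈ T) a b

lemma Good.contract_all (T : List (Bool × ℕ × ℕ)) :
    ∀ (X Y : List Letter), Good (X ++ (topRow T).reverse ++ (botRow T).map inv ++ Y) →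
      ∃ f : ℕ → ℕ, Good ((X ++ Y).map (relabel f)) ∧ (∀ t ∈ T, f t.2.1 = f t.2.2) ∧
        ∀ a b, f a = f b → Joined T a b := by
  induction hn : T.length generalizing T with
  | zero =>
    intro X Y h
    obtain rfl := List.length_eq_zero_iff.1 hn
    refine ⟨id, ?_, by simp, ?_⟩
    · rw [map_relabel_eq_self (by simp)]; simpa [topRow, botRow] using h
    · rintro a b rfl; exact Relation.EqvGen.refl _
  | succ n ih =>
    intro X Y h
    obtain _ | ⟨⟨c, x, y⟩, T⟩ := T
    · simp at hn
    have h1 := h.contract (X ++ (topRow T).reverse) ((botRow T).map inv ++ Y) c x y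
      (by simp [topRow, botRow])
    obtain ⟨f, hf, hfT, hfJ⟩ := ih
      (T.map fun t => (t.1, subst x y t.2.1, subst x y t.2.2)) (by simpa using hn)
      (X.map (relabel (subst x y))) (Y.map (relabel (subst x y))) (by
        simpa [topRow, botRow, relabel, inv, Function.comp_def] using h1)
    have hs : ∀ a, Joined ((c, x, y) :: T) a (subst x y a) := by
      intro a
      unfold subst
      split_ifs with h
      · subst h; exact Relation.EqvGen.rel _ _ ⟨c, by simp⟩
      · exact Relation.EqvGen.refl _
    refine ⟨f ∘ subst x y, ?_, ?_, ?_⟩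
    · rw [← map_relabel_map]; simpa using hf
    · intro t ht
      rcases List.mem_cons.1 ht with rfl | ht
      · simp [subst]
      · exact hfT _ (List.mem_map.2 ⟨t, ht, rfl⟩)
    · intro a b hab
      have h2 := hfJ _ _ hab
      have h3 : ∀ a b, Joined (T.map fun t => (t.1, subst x y t.2.1, subst x y t.2.2)) a b →
          Joined ((c, x, y) :: T) a b := by
        intro a b h
        induction h with
        | rel a b h =>
          obtain ⟨d, hd⟩ := h
          obtain ⟨⟨d', p, q⟩, ht, hte⟩ := List.mem_map.1 hd
          simp only [Prod.mk.injEq] at hte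
          obtain ⟨rfl, rfl, rfl⟩ := hte
          exact ((hs p).symm.trans _ _ _
            (Relation.EqvGen.rel _ _ ⟨d', List.mem_cons_of_mem _ ht⟩)).trans _ _ _ (hs q)
        | refl a => exact Relation.EqvGen.refl _
        | symm a b _ ih => exact ih.symm
        | trans a b c _ _ ih1 ih2 => exact ih1.trans _ _ _ ih2
      exact ((hs a).trans _ _ _ (h3 _ _ h2)).trans _ _ _ (hs b).symm

lemma TCP.ext_cast {p q : TCP} (hk : p.k = q.k) (hl : p.l = q.l)
    (hu : ∀ i, p.upColor i = q.upColor (Fin.cast hk i))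
    (hd : ∀ i, p.lowColor i = q.lowColor (Fin.cast hl i))
    (hr : ∀ x y, p.rel.r x y ↔ q.rel.r (Sum.map (Fin.cast hk) (Fin.cast hl) x)
      (Sum.map (Fin.cast hk) (Fin.cast hl) y)) : p = q := by
  obtain ⟨k, l, u, d, r⟩ := p
  obtain ⟨k', l', u', d', r'⟩ := q
  dsimp only at hk hl
  subst hk hl
  have e1 : u = u' := funext hu
  have e2 : d = d' := funext hd
  have e3 : r = r' := by
    ext x y
    simpa using hr x y
  rw [e1, e2, e3]

/-- The block labels of the points of the partition described by two rows of letters. -/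
def lbl (U L : List Letter) : Fin U.length ⊕ Fin L.length → ℕ :=
  Sum.elim (fun i => (U.get i).2) (fun j => (L.get j).2)

/-- The partition whose upper and lower rows are described by lists of labelled points. -/
def ofLists (U L : List Letter) : TCP where
  k := U.length
  l := L.length
  upColor := fun i => (U.get i).1
  lowColor := fun j => (L.get j).1
  rel := Setoid.ker (lbl U L)

lemma exists_mem_of_lbl (U L : List Letter) (x : Fin U.length ⊕ Fin L.length) :
    ∃ e ∈ U ++ L, e.2 = lbl U L x := by
  rcases x with i | j
  · exact ⟨U.get i, by simp, rfl⟩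
  · exact ⟨L.get j, by simp, rfl⟩

lemma eq_ofLists {p : TCP} {U L : List Letter} (hk : p.k = U.length) (hl : p.l = L.length)
    (hu : ∀ i : Fin p.k, p.upColor i = (U[i.1]'(hk ▸ i.2)).1)
    (hd : ∀ j : Fin p.l, p.lowColor j = (L[j.1]'(hl ▸ j.2)).1)
    (f : Fin p.k ⊕ Fin p.l → ℕ) (hfu : ∀ i, f (Sum.inl i) = (U[i.1]'(hk ▸ i.2)).2)
    (hfd : ∀ j, f (Sum.inr j) = (L[j.1]'(hl ▸ j.2)).2)
    (hr : ∀ x y, p.rel.r x y ↔ f x = f y) : p = ofLists U L := by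
  refine TCP.ext_cast hk hl hu hd fun x y => ?_
  have key : ∀ x, f x = lbl U L (Sum.map (Fin.cast hk) (Fin.cast hl) x) := by
    rintro (i | j)
    · exact hfu i
    · exact hfd j
  rw [hr, key, key]
  rfl

lemma exists_eq_ofLists (p : TCP) : ∃ U L, p = ofLists U L := by
  obtain ⟨e, he⟩ := exists_injective_nat (Quotient p.rel)
  refine ⟨List.ofFn fun i => (p.upColor i, e (Quotient.mk _ (Sum.inl i))),
    List.ofFn fun j => (p.lowColor j, e (Quotient.mk _ (Sum.inr j))), ?_⟩
  refine eq_ofLists (by simp) (by simp) (by simp) (by simp)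
    (fun x => e (Quotient.mk p.rel x)) (by simp) (by simp) fun x y =>
      ⟨fun h => congrArg e (Quotient.sound h), fun h => Quotient.exact (he h)⟩

lemma ofLists_relabel (U L : List Letter) (f : ℕ → ℕ)
    (hf : ∀ e ∈ U ++ L, ∀ e' ∈ U ++ L, f e.2 = f e'.2 → e.2 = e'.2) :
    ofLists (U.map (relabel f)) (L.map (relabel f)) = ofLists U L := by
  refine (eq_ofLists (p := ofLists U L) (by simp [ofLists]) (by simp [ofLists])
    (by simp [ofLists]) (by simp [ofLists]) (fun x => f (lbl U L x))
    (fun i => by simp only [List.getElem_map, relabel_snd]; rfl)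
    (fun j => by simp only [List.getElem_map, relabel_snd]; rfl) fun x y => ?_).symm
  refine ⟨fun h => congrArg f h, fun h => ?_⟩
  change lbl U L x = lbl U L y
  obtain ⟨e, he, h1⟩ := exists_mem_of_lbl U L x
  obtain ⟨e', he', h2⟩ := exists_mem_of_lbl U L y
  rw [← h1, ← h2] at h ⊢
  exact hf e he e' he' h

lemma invol_ofLists (U L : List Letter) : invol (ofLists U L) = ofLists L U :=
  eq_ofLists rfl rfl (fun _ => rfl) (fun _ => rfl) (fun x => lbl U L x.swap)
    (fun _ => rfl) (fun _ => rfl) fun _ _ => Iff.rfl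

lemma tensor_ofLists (U L U' L' : List Letter)
    (hd : ∀ e ∈ U ++ L, ∀ e' ∈ U' ++ L', e.2 ≠ e'.2) :
    tensor (ofLists U L) (ofLists U' L') = ofLists (U ++ U') (L ++ L') := by
  have hsplit : ∀ (A B : List Letter) (i : Fin (A.length + B.length)),
      Sum.elim (fun i => A.get i) (fun i => B.get i) (finSumFinEquiv.symm i) =
        (A ++ B)[i.1]'(by simp) := by
    intro A B i
    refine Fin.addCases (fun i => ?_) (fun i => ?_) i <;> simp
  have hcase : ∀ {α β γ δ : Type} (g : γ → δ) (s : α ⊕ β) (a : α → γ) (b : β → γ),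
      s.elim (fun x => g (a x)) (fun x => g (b x)) = g (s.elim a b) := by
    rintro α β γ δ g (s | s) a b <;> rfl
  have hcase' : ∀ {α β γ δ ε : Type} (g : γ → ε) (g' : δ → ε) (s : α ⊕ β) (a : α → γ) (b : β → δ),
      Sum.elim g g' (s.elim (fun x => Sum.inl (a x)) (fun x => Sum.inr (b x))) =
        s.elim (fun x => g (a x)) (fun x => g' (b x)) := by
    rintro α β γ δ ε g g' (s | s) a b <;> rfl
  refine eq_ofLists (by simp [ofLists, tensor]) (by simp [ofLists, tensor]) ?_ ?_
    (fun x => Sum.elim (lbl U L) (lbl U' L') (splitPt (ofLists U L) (ofLists U' L') x)) ?_ ?_ ?_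
  · intro i
    exact (hcase Prod.fst _ _ _).trans (congrArg Prod.fst (hsplit U U' i))
  · intro i
    exact (hcase Prod.fst _ _ _).trans (congrArg Prod.fst (hsplit L L' i))
  · intro i
    exact (hcase' _ _ _ _ _).trans
      ((hcase Prod.snd _ _ _).trans (congrArg Prod.snd (hsplit U U' i)))
  · intro i
    exact (hcase' _ _ _ _ _).trans
      ((hcase Prod.snd _ _ _).trans (congrArg Prod.snd (hsplit L L' i)))
  · have hne : ∀ a b, lbl U L a ≠ lbl U' L' b := by
      intro a b
      obtain ⟨e, he, h1⟩ := exists_mem_of_lbl U L a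
      obtain ⟨e', he', h2⟩ := exists_mem_of_lbl U' L' b
      rw [← h1, ← h2]
      exact hd e he e' he'
    have key : ∀ a b, sumRel (ofLists U L).rel (ofLists U' L').rel a b ↔
        Sum.elim (lbl U L) (lbl U' L') a = Sum.elim (lbl U L) (lbl U' L') b := by
      rintro (a | a) (b | b)
      · exact Iff.rfl
      · exact iff_of_false id (hne a b)
      · exact iff_of_false id (hne b a).symm
      · exact Iff.rfl
    intro x y
    exact key _ _

@[simp] lemma length_topRow (T : List (Bool × ℕ × ℕ)) : (topRow T).length = T.length := by
  simp [topRow]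
@[simp] lemma length_botRow (T : List (Bool × ℕ × ℕ)) : (botRow T).length = T.length := by
  simp [botRow]

/-- The label of a point of a composition, including the middle points. -/
def compLbl (U L : List Letter) (T : List (Bool × ℕ × ℕ)) :
    ((Fin U.length ⊕ Fin (topRow T).length) ⊕ Fin L.length) → ℕ :=
  Sum.elim (lbl U (topRow T)) (fun j => (L.get j).2)

lemma lbl_compEmbMid (U L : List Letter) (T : List (Bool × ℕ × ℕ))
    (h : (ofLists U (topRow T)).l = (ofLists (botRow T) L).k)
    (x : Fin (botRow T).length ⊕ Fin L.length) :
    Joined T (compLbl U L T (compEmbMid (ofLists U (topRow T)) (ofLists (botRow T) L) h x))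
      (lbl (botRow T) L x) := by
  rcases x with i | j
  · refine Relation.EqvGen.rel _ _ ⟨(T[i.1]'(by simpa using i.2)).1, ?_⟩
    have h1 : (T[i.1]'(by simpa using i.2)) ∈ T := List.getElem_mem _
    have h2 : ((topRow T)[i.1]'(by simpa using i.2)).2 = (T[i.1]'(by simpa using i.2)).2.1 := by
      simp [topRow]
    have h3 : ((botRow T)[i.1]'i.2).2 = (T[i.1]'(by simpa using i.2)).2.2 := by
      simp [botRow]
    change (_, ((topRow T)[i.1]'(by simpa using i.2)).2, ((botRow T)[i.1]'i.2).2) ∈ T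
    rwa [h2, h3]
  · exact Relation.EqvGen.refl _

lemma eqvGen_compRel_of_joined (U L : List Letter) (T : List (Bool × ℕ × ℕ))
    (hd : ∀ e ∈ U ++ topRow T, ∀ e' ∈ botRow T ++ L, e.2 ≠ e'.2)
    (h : (ofLists U (topRow T)).l = (ofLists (botRow T) L).k)
    (P : ((Fin U.length ⊕ Fin (topRow T).length) ⊕ Fin L.length) → ℕ → Prop)
    (hP : ∀ t a, P t a ↔ (∃ x, t = Sum.inl x ∧ lbl U (topRow T) x = a) ∨
      (∃ x, t = compEmbMid (ofLists U (topRow T)) (ofLists (botRow T) L) h x ∧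
        lbl (botRow T) L x = a))
    {a b : ℕ} (hab : Joined T a b) :
    a = b ∨ ((∃ t, P t a) ∧ (∃ t, P t b) ∧ ∀ t t', P t a → P t' b →
      Relation.EqvGen (compRel (ofLists U (topRow T)) (ofLists (botRow T) L) h) t t') := by
  have hsame : ∀ t t' a, P t a → P t' a →
      Relation.EqvGen (compRel (ofLists U (topRow T)) (ofLists (botRow T) L) h) t t' := by
    intro t t' a h1 h2
    have hne : ∀ x y, lbl U (topRow T) x ≠ lbl (botRow T) L y := by
      intro x y
      obtain ⟨e, he, h1⟩ := exists_mem_of_lbl _ _ x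
      obtain ⟨e', he', h2⟩ := exists_mem_of_lbl _ _ y
      rw [← h1, ← h2]
      exact hd e he e' he'
    rw [hP] at h1 h2
    rcases h1 with ⟨x, rfl, hx⟩ | ⟨x, rfl, hx⟩ <;> rcases h2 with ⟨y, rfl, hy⟩ | ⟨y, rfl, hy⟩
    · exact Relation.EqvGen.rel _ _ (Or.inl ⟨x, y, hx.trans hy.symm, rfl, rfl⟩)
    · exact (hne x y (hx.trans hy.symm)).elim
    · exact (hne y x (hy.trans hx.symm)).elim
    · exact Relation.EqvGen.rel _ _ (Or.inr ⟨x, y, hx.trans hy.symm, rfl, rfl⟩)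
  induction hab with
  | rel a b hab =>
    obtain ⟨c, hc⟩ := hab
    obtain ⟨i, hi, hiT⟩ := List.mem_iff_getElem.1 hc
    right
    have h1 : P (Sum.inl (Sum.inr ⟨i, by simpa using hi⟩)) a :=
      (hP _ _).2 (Or.inl ⟨_, rfl, by simp [lbl, topRow, hiT]⟩)
    have hib : i < (botRow T).length := by simpa using hi
    have h2 : P (Sum.inl (Sum.inr ⟨i, by simpa using hi⟩)) b :=
      (hP _ _).2 (Or.inr ⟨Sum.inl ⟨i, hib⟩, rfl,
        (by simp [botRow, hiT] : ((botRow T)[i]'hib).2 = b)⟩)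
    exact ⟨⟨_, h1⟩, ⟨_, h2⟩, fun t t' ht ht' =>
      (hsame _ _ _ ht h1).trans _ _ _ (hsame _ _ _ h2 ht')⟩
  | refl a => exact Or.inl rfl
  | symm a b _ ih =>
    rcases ih with rfl | ⟨h1, h2, h3⟩
    · exact Or.inl rfl
    · exact Or.inr ⟨h2, h1, fun t t' ht ht' => (h3 _ _ ht' ht).symm⟩
  | trans a b c _ _ ih1 ih2 =>
    rcases ih1 with rfl | ⟨h1, h2, h3⟩
    · exact ih2
    rcases ih2 with rfl | ⟨h4, h5, h6⟩
    · exact Or.inr ⟨h1, h2, h3⟩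
    · obtain ⟨s, hs⟩ := h2
      exact Or.inr ⟨h1, h5, fun t t' ht ht' => (h3 _ _ ht hs).trans _ _ _ (h6 _ _ hs ht')⟩

/-- Composition in terms of labelled rows: the labels of the middle points are identified. -/
lemma comp_ofLists (U L : List Letter) (T : List (Bool × ℕ × ℕ))
    (hd : ∀ e ∈ U ++ topRow T, ∀ e' ∈ botRow T ++ L, e.2 ≠ e'.2)
    (h : (ofLists U (topRow T)).l = (ofLists (botRow T) L).k)
    (f : ℕ → ℕ) (hfT : ∀ t ∈ T, f t.2.1 = f t.2.2)
    (hfJ : ∀ e ∈ U ++ L, ∀ e' ∈ U ++ L, f e.2 = f e'.2 → Joined T e.2 e'.2) :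
    comp (ofLists U (topRow T)) (ofLists (botRow T) L) h =
      ofLists (U.map (relabel f)) (L.map (relabel f)) := by
  refine eq_ofLists (by simp [ofLists, comp]) (by simp [ofLists, comp]) (by simp [ofLists, comp])
    (by simp [ofLists, comp]) (fun x => f (lbl U L x))
    (fun i => by simp only [List.getElem_map, relabel_snd]; rfl)
    (fun j => by simp only [List.getElem_map, relabel_snd]; rfl) ?_
  · have hJf : ∀ a b, Joined T a b → f a = f b := by
      intro a b hab
      induction hab with
      | rel a b hab => obtain ⟨c, hc⟩ := hab; exact hfT _ hc
      | refl a => rfl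
      | symm a b _ ih => exact ih.symm
      | trans a b c _ _ ih1 ih2 => exact ih1.trans ih2
    have hcomp : ∀ t t', Relation.EqvGen
        (compRel (ofLists U (topRow T)) (ofLists (botRow T) L) h) t t' →
        f (compLbl U L T t) = f (compLbl U L T t') := by
      intro t t' htt
      induction htt with
      | rel t t' htt =>
        rcases htt with ⟨x, y, hxy, rfl, rfl⟩ | ⟨x, y, hxy, rfl, rfl⟩
        · exact congrArg f hxy
        · have h1 := hJf _ _ (lbl_compEmbMid U L T h x)
          have h2 := hJf _ _ (lbl_compEmbMid U L T h y)
          rw [h1, h2]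
          exact congrArg f hxy
      | refl a => rfl
      | symm a b _ ih => exact ih.symm
      | trans a b c _ _ ih1 ih2 => exact ih1.trans ih2
    have key2 : ∀ x : Fin U.length ⊕ Fin L.length, compLbl U L T
        (Sum.elim (fun i => Sum.inl (Sum.inl i)) (fun j => Sum.inr j) x) = lbl U L x := by
      rintro (i | i) <;> simp [lbl, compLbl]
    intro x y
    change Fin U.length ⊕ Fin L.length at x y
    change Relation.EqvGen _
      (Sum.elim (fun i => Sum.inl (Sum.inl i)) (fun j => Sum.inr j) x)
      (Sum.elim (fun i => Sum.inl (Sum.inl i)) (fun j => Sum.inr j) y) ↔ _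
    refine ⟨fun hxy => ?_, fun hxy => ?_⟩
    · exact (congrArg f (key2 x)).symm.trans ((hcomp _ _ hxy).trans (congrArg f (key2 y)))
    obtain ⟨e, he, h1⟩ := exists_mem_of_lbl _ _ x
    obtain ⟨e', he', h2⟩ := exists_mem_of_lbl _ _ y
    have hj : Joined T (lbl U L x) (lbl U L y) := by
      rw [← h1, ← h2] at hxy ⊢
      exact hfJ e he e' he' hxy
    have hpt : ∀ x : Fin U.length ⊕ Fin L.length,
        (∃ z, (Sum.elim (fun i => Sum.inl (Sum.inl i)) (fun j => Sum.inr j) x :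
          ((Fin U.length ⊕ Fin (topRow T).length) ⊕ Fin L.length)) = Sum.inl z ∧
            lbl U (topRow T) z = lbl U L x) ∨
        (∃ z, (Sum.elim (fun i => Sum.inl (Sum.inl i)) (fun j => Sum.inr j) x :
          ((Fin U.length ⊕ Fin (topRow T).length) ⊕ Fin L.length)) =
            compEmbMid (ofLists U (topRow T)) (ofLists (botRow T) L) h z ∧
          lbl (botRow T) L z = lbl U L x) := by
      rintro (i | j)
      · exact Or.inl ⟨Sum.inl i, rfl, rfl⟩
      · exact Or.inr ⟨Sum.inr j, rfl, rfl⟩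
    rcases eqvGen_compRel_of_joined U L T hd h _ (fun _ _ => Iff.rfl) hj with heq | ⟨-, -, h3⟩
    · rcases x with i | i <;> rcases y with j | j
      · exact Relation.EqvGen.rel _ _ (Or.inl ⟨Sum.inl i, Sum.inl j, heq, rfl, rfl⟩)
      · exact (hd (U.get i) (by simp) (L.get j) (by simp) heq).elim
      · exact (hd (U.get j) (by simp) (L.get i) (by simp) heq.symm).elim
      · exact Relation.EqvGen.rel _ _ (Or.inr ⟨Sum.inr i, Sum.inr j, heq, rfl, rfl⟩)
    · exact h3 _ _ (hpt x) (hpt y)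

lemma exists_label_bound (w : List Letter) : ∃ N, ∀ e ∈ w, e.2 < N := by
  induction w with
  | nil => exact ⟨0, by simp⟩
  | cons a w ih =>
    obtain ⟨N, hN⟩ := ih
    refine ⟨max N (a.2 + 1), fun e he => ?_⟩
    rcases List.mem_cons.1 he with rfl | he
    · exact lt_of_lt_of_le (Nat.lt_succ_self _) (le_max_right _ _)
    · exact lt_of_lt_of_le (hN e he) (le_max_left _ _)

lemma exists_rows {M M' : List Letter} (hlen : M.length = M'.length)
    (hc : ∀ (i : ℕ) (h : i < M.length) (h' : i < M'.length), M[i].1 = M'[i].1) :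
    ∃ T, M = topRow T ∧ M' = botRow T := by
  refine ⟨List.zipWith (fun a b => (a.1, a.2, b.2)) M M', ?_, ?_⟩
  · refine List.ext_getElem (by simp [hlen]) fun i h1 h2 => ?_
    simp [topRow]
  · refine List.ext_getElem (by simp [hlen]) fun i h1 h2 => ?_
    simp [botRow, hc i (hlen ▸ h1) h1]

/-- The word obtained by rotating all upper points down to the left of the lower row. -/
def line (U L : List Letter) : List Letter := flip U ++ L

lemma mem_line {U L : List Letter} {e : Letter} (he : e ∈ line U L) :
    ∃ e' ∈ U ++ L, e'.2 = e.2 := by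
  rcases List.mem_append.1 he with he | he
  · simp only [flip, List.mem_reverse, List.mem_map] at he
    obtain ⟨e', h, rfl⟩ := he
    exact ⟨e', List.mem_append_left _ h, rfl⟩
  · exact ⟨e, List.mem_append_right _ he, rfl⟩

lemma map_relabel_line (f : ℕ → ℕ) (U L : List Letter) :
    (line U L).map (relabel f) = line (U.map (relabel f)) (L.map (relabel f)) := by
  simp [line, map_relabel_flip]

/-- The partitions that are described by a good word. -/
def goodSet : Set TCP := {p | ∃ U L, p = ofLists U L ∧ Good (line U L)}

lemma exists_shift {p : TCP} (hp : p ∈ goodSet) (N : ℕ) :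
    ∃ U L, p = ofLists U L ∧ Good (line U L) ∧ ∀ e ∈ U ++ L, N ≤ e.2 := by
  obtain ⟨U, L, rfl, h⟩ := hp
  refine ⟨U.map (relabel (· + N)), L.map (relabel (· + N)), ?_, ?_, ?_⟩
  · exact (ofLists_relabel _ _ _ (by simp)).symm
  · rw [← map_relabel_line]
    exact h.map _ (by simp)
  · intro e he
    rw [← List.map_append] at he
    obtain ⟨e', -, rfl⟩ := List.mem_map.1 he
    simp

lemma tensor_mem_goodSet {p q : TCP} (hp : p ∈ goodSet) (hq : q ∈ goodSet) :
    tensor p q ∈ goodSet := by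
  obtain ⟨U, L, rfl, h⟩ := hp
  obtain ⟨N, hN⟩ := exists_label_bound (U ++ L)
  obtain ⟨U', L', rfl, h', hN'⟩ := exists_shift hq N
  refine ⟨U ++ U', L ++ L', tensor_ofLists _ _ _ _ fun e he e' he' => ?_, ?_⟩
  · have := hN e he
    have := hN' e' he'
    omega
  · have := Good.insert (X := flip U') (Y := L') h' h fun e he e' he' => by
      obtain ⟨a, ha, h1⟩ := mem_line he
      obtain ⟨b, hb, h2⟩ := mem_line he'
      have := hN a ha
      have := hN' b hb
      omega
    simpa [line] using this

lemma joined_reverse {T : List (Bool × ℕ × ℕ)} {a b : ℕ} (h : Joined T.reverse a b) :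
    Joined T a b := by
  simpa [Joined] using h

lemma comp_mem_goodSet {p q : TCP} (hq : q ∈ goodSet) (hp : p ∈ goodSet) (h : q.l = p.k)
    (hc : ColorsMatch q p h) : comp q p h ∈ goodSet := by
  obtain ⟨U, M, rfl, hq⟩ := hq
  obtain ⟨N, hN⟩ := exists_label_bound (U ++ M)
  obtain ⟨M', L, rfl, hp, hN'⟩ := exists_shift hp N
  obtain ⟨T, rfl, rfl⟩ := exists_rows (M := M) (M' := M') h fun i hi hi' => hc ⟨i, hi⟩
  have hd : ∀ e ∈ U ++ topRow T, ∀ e' ∈ botRow T ++ L, e.2 ≠ e'.2 := by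
    intro e he e' he'
    have := hN e he
    have := hN' e' he'
    omega
  have h1 : Good (line U (topRow T) ++ line (botRow T) L ++ []) :=
    Good.insert (by simpa using hq) hp fun e he e' he' => by
      obtain ⟨a, ha, h1⟩ := mem_line he
      obtain ⟨b, hb, h2⟩ := mem_line (by simpa using he')
      have := hd b hb a ha
      omega
  obtain ⟨f, hf, hfT, hfJ⟩ := Good.contract_all T.reverse (flip U) L (by
    simpa [line, topRow, botRow, flip] using h1)
  refine ⟨U.map (relabel f), L.map (relabel f), comp_ofLists U L T hd h f
    (fun t ht => hfT t (by simpa using ht))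
    (fun e _ e' _ he => joined_reverse (hfJ _ _ he)), ?_⟩
  rw [← map_relabel_line]
  exact hf

lemma idPart_eq (c : Bool) (x : ℕ) : idPart c = ofLists [(c, x)] [(c, x)] :=
  eq_ofLists rfl rfl (by simp [idPart]) (by simp [idPart]) (fun _ => x) (by simp) (by simp)
    fun _ _ => iff_of_true trivial rfl

lemma pairLower_eq (c d : Bool) (x : ℕ) : pairLower c d = ofLists [] [(c, x), (d, x)] := by
  refine eq_ofLists rfl rfl (fun i => i.elim0) ?_ (fun _ => x) (fun i => i.elim0) ?_ ?_
  · intro j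
    change Fin 2 at j
    fin_cases j <;> rfl
  · intro j
    change Fin 2 at j
    fin_cases j <;> rfl
  · rintro (x | x) (y | y)
    · exact x.elim0
    · exact x.elim0
    · exact y.elim0
    · exact iff_of_true rfl rfl

lemma singl_eq (c : Bool) (x : ℕ) : singl c = ofLists [] [(c, x)] := by
  refine eq_ofLists rfl rfl (fun i => i.elim0) ?_ (fun _ => x) (fun i => i.elim0) ?_ ?_
  · intro j
    change Fin 1 at j
    fin_cases j; rfl
  · intro j
    change Fin 1 at j
    fin_cases j; rfl
  · rintro (x | x) (y | y)
    · exact x.elim0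
    · exact x.elim0
    · exact y.elim0
    · exact iff_of_true rfl rfl

lemma singPair_eq {x y : ℕ} (h : x ≠ y) : singPair = ofLists [] [(true, x), (false, y)] := by
  rw [singPair, singl_eq white x, singl_eq black y]
  exact tensor_ofLists _ _ _ _ (by simpa using h)

lemma good_pair (c : Bool) (x : ℕ) : Good [(c, x), (!c, x)] :=
  Good.pair [] [] c x Good.nil (by simp)

lemma isCategory_goodSet : IsCategory goodSet where
  tensor_mem _ hp _ hq := tensor_mem_goodSet hp hq
  comp_mem _ hq _ hp h hc := comp_mem_goodSet hq hp h hc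
  invol_mem p hp := by
    obtain ⟨U, L, rfl, h⟩ := hp
    exact ⟨L, U, invol_ofLists _ _, by simpa [line] using h.flip⟩
  idw_mem := ⟨_, _, idPart_eq true 0, good_pair false 0⟩
  idb_mem := ⟨_, _, idPart_eq false 0, good_pair true 0⟩
  pairwb_mem := ⟨_, _, pairLower_eq true false 0, good_pair true 0⟩
  pairbw_mem := ⟨_, _, pairLower_eq false true 0, good_pair false 0⟩

lemma singPair_mem_goodSet : singPair ∈ goodSet :=
  ⟨_, _, singPair_eq zero_ne_one,
    Good.sing [] [] true 0 1 Good.nil (by simp) (by simp) zero_ne_one⟩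

/-- A row with the colors of `M` and with the consecutive labels `N, N + 1, …`. -/
def idRow (N : ℕ) (M : List Letter) : List Letter := (M.zipIdx N).map fun e => (e.1.1, e.2)

/-- The row `M` together with the labels of `idRow N M`. -/
def idPairs (N : ℕ) (M : List Letter) : List (Bool × ℕ × ℕ) :=
  (M.zipIdx N).map fun e => (e.1.1, e.1.2, e.2)

/-- The map sending the labels of `idRow N M` to those of `M`, and fixing the labels below `N`. -/
def idLbl (N : ℕ) (M : List Letter) (x : ℕ) : ℕ :=
  if x < N then x else (M.getD (x - N) (true, 0)).2

lemma topRow_idPairs (N : ℕ) (M : List Letter) : topRow (idPairs N M) = M :=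
  List.ext_getElem (by simp [idPairs]) fun i _ _ => by simp [topRow, idPairs]

lemma botRow_idPairs (N : ℕ) (M : List Letter) : botRow (idPairs N M) = idRow N M :=
  List.ext_getElem (by simp [idPairs, idRow]) fun i _ _ => by simp [botRow, idPairs, idRow]

@[simp] lemma length_idRow (N : ℕ) (M : List Letter) : (idRow N M).length = M.length := by
  simp [idRow]

lemma idRow_append (N : ℕ) (A B : List Letter) :
    idRow N (A ++ B) = idRow N A ++ idRow (N + A.length) B := by
  simp [idRow, List.zipIdx_append]

lemma le_of_mem_idRow {N : ℕ} {M : List Letter} {e : Letter} (he : e ∈ idRow N M) : N ≤ e.2 := by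
  simp only [idRow, List.mem_map] at he
  obtain ⟨⟨a, i⟩, h, rfl⟩ := he
  exact (List.mem_zipIdx h).1

lemma idLbl_of_lt {N : ℕ} {M : List Letter} {x : ℕ} (h : x < N) : idLbl N M x = x := by
  simp [idLbl, h]

lemma idLbl_add {N i : ℕ} {M : List Letter} (h : i < M.length) : idLbl N M (N + i) = M[i].2 := by
  simp [idLbl, h]

lemma map_idLbl_idRow (N : ℕ) (M : List Letter) : (idRow N M).map (relabel (idLbl N M)) = M := by
  refine List.ext_getElem (by simp) fun i h1 h2 => ?_
  simp [idRow, idLbl_add h2]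

lemma idLbl_of_mem_idPairs {N : ℕ} {M : List Letter} {t : Bool × ℕ × ℕ} (ht : t ∈ idPairs N M) :
    N ≤ t.2.2 ∧ idLbl N M t.2.2 = t.2.1 := by
  simp only [idPairs, List.mem_map] at ht
  obtain ⟨⟨a, i⟩, h, rfl⟩ := ht
  obtain ⟨h1, h2, h3⟩ := List.mem_zipIdx h
  refine ⟨h1, ?_⟩
  obtain ⟨j, rfl⟩ := Nat.exists_eq_add_of_le h1
  simp only
  rw [idLbl_add (by omega), h3]
  simp

lemma joined_idPairs {N : ℕ} {M : List Letter} {e : Letter} (he : e ∈ idRow N M) :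
    Joined (idPairs N M) e.2 (idLbl N M e.2) := by
  rw [← botRow_idPairs] at he
  simp only [botRow, List.mem_map] at he
  obtain ⟨t, ht, rfl⟩ := he
  rw [(idLbl_of_mem_idPairs ht).2]
  exact (Relation.EqvGen.rel _ _ ⟨t.1, ht⟩).symm

lemma Joined.mono {T T' : List (Bool × ℕ × ℕ)} (h : ∀ t ∈ T, t ∈ T') {a b : ℕ}
    (hab : Joined T a b) : Joined T' a b := by
  induction hab with
  | rel _ _ hc => exact Relation.EqvGen.rel _ _ (hc.imp fun _ hc => h _ hc)
  | refl _ => exact Relation.EqvGen.refl _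
  | symm _ _ _ ih => exact Relation.EqvGen.symm _ _ ih
  | trans _ _ _ _ _ ih ih' => exact Relation.EqvGen.trans _ _ _ ih ih'

lemma comp_ofLists_of_joined (U M M' L : List Letter) (T : List (Bool × ℕ × ℕ))
    (hM : topRow T = M) (hM' : botRow T = M')
    (hd : ∀ e ∈ U ++ M, ∀ e' ∈ M' ++ L, e.2 ≠ e'.2)
    (f : ℕ → ℕ) (hfT : ∀ t ∈ T, f t.2.1 = f t.2.2)
    (hfJ : ∀ e ∈ U ++ L, Joined T e.2 (f e.2)) :
    ∃ h : (ofLists U M).l = (ofLists M' L).k, ColorsMatch (ofLists U M) (ofLists M' L) h ∧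
      comp (ofLists U M) (ofLists M' L) h =
        ofLists (U.map (relabel f)) (L.map (relabel f)) := by
  subst hM hM'
  have h : (ofLists U (topRow T)).l = (ofLists (botRow T) L).k := by simp [ofLists]
  refine ⟨h, fun j => ?_, comp_ofLists U L T hd h f hfT fun e he e' he' hee =>
    (hfJ e he).trans _ _ _ (hee ▸ (hfJ e' he').symm)⟩
  simp [ofLists, topRow, botRow]
  rfl

namespace IsCategory

variable {C : Set TCP}

lemma id_mem (hC : IsCategory C) (c : Bool) (x : ℕ) : ofLists [(c, x)] [(c, x)] ∈ C := by
  rw [← idPart_eq]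
  cases c
  · exact hC.idb_mem
  · exact hC.idw_mem

lemma pair_mem (hC : IsCategory C) (c : Bool) (x : ℕ) : ofLists [] [(c, x), (!c, x)] ∈ C := by
  rw [← pairLower_eq]
  cases c
  · exact hC.pairbw_mem
  · exact hC.pairwb_mem

lemma invol_ofLists_mem (hC : IsCategory C) {U L : List Letter} (h : ofLists U L ∈ C) :
    ofLists L U ∈ C := by
  rw [← invol_ofLists]
  exact hC.invol_mem _ h

lemma tensor_ofLists_mem (hC : IsCategory C) {U L U' L' : List Letter} (h : ofLists U L ∈ C)
    (h' : ofLists U' L' ∈ C) (hd : ∀ e ∈ U ++ L, ∀ e' ∈ U' ++ L', e.2 ≠ e'.2) :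
    ofLists (U ++ U') (L ++ L') ∈ C := by
  rw [← tensor_ofLists _ _ _ _ hd]
  exact hC.tensor_mem _ h _ h'

lemma comp_ofLists_mem (hC : IsCategory C) {U M M' L : List Letter} (T : List (Bool × ℕ × ℕ))
    (hq : ofLists U M ∈ C) (hp : ofLists M' L ∈ C) (hM : topRow T = M) (hM' : botRow T = M')
    (hd : ∀ e ∈ U ++ M, ∀ e' ∈ M' ++ L, e.2 ≠ e'.2)
    (f : ℕ → ℕ) (hfT : ∀ t ∈ T, f t.2.1 = f t.2.2)
    (hfJ : ∀ e ∈ U ++ L, Joined T e.2 (f e.2)) :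
    ofLists (U.map (relabel f)) (L.map (relabel f)) ∈ C := by
  obtain ⟨h, hc, he⟩ := comp_ofLists_of_joined U M M' L T hM hM' hd f hfT hfJ
  rw [← he]
  exact hC.comp_mem _ hq _ hp h hc

lemma empty_mem (hC : IsCategory C) : ofLists [] [] ∈ C :=
  hC.comp_ofLists_mem (U := []) (L := []) [(true, 0, 1), (false, 0, 1)] (hC.pair_mem true 0)
    (hC.invol_ofLists_mem (hC.pair_mem true 1)) rfl rfl (by simp) (fun _ => 0) (by simp) (by simp)

lemma idRow_mem (hC : IsCategory C) (M : List Letter) :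
    ∀ N, ofLists (idRow N M) (idRow N M) ∈ C := by
  induction M with
  | nil => exact fun _ => hC.empty_mem
  | cons a M ih =>
    intro N
    have := hC.tensor_ofLists_mem (hC.id_mem a.1 N) (ih (N + 1)) (by
      intro e he e' he'
      have h1 : e.2 = N := by
        simp only [List.cons_append, List.nil_append, List.mem_cons, List.not_mem_nil,
          or_false, or_self] at he
        rw [he]
      have h2 : e' ∈ idRow (N + 1) M := by simpa using he'
      have := le_of_mem_idRow h2
      omega)
    simpa [idRow] using this

/-- Inserting two adjacent lower points. -/
lemma insert_mem (hC : IsCategory C) {U A B : List Letter} {a b : Letter}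
    (h : ofLists U (A ++ B) ∈ C) (hs : ofLists [] [a, b] ∈ C)
    (ha : Fresh a.2 (U ++ (A ++ B))) (hb : Fresh b.2 (U ++ (A ++ B))) :
    ofLists U (A ++ a :: b :: B) ∈ C := by
  obtain ⟨N, hN⟩ := exists_label_bound (a :: b :: (U ++ (A ++ B)))
  have haN := hN a (by simp)
  have hbN := hN b (by simp)
  have hids := hC.tensor_ofLists_mem (hC.tensor_ofLists_mem (hC.idRow_mem A N) hs (by
    intro e he e' he'
    have := le_of_mem_idRow (by simpa using he)
    have h2 : e' = a ∨ e' = b := by simpa using he'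
    rcases h2 with rfl | rfl <;> omega)) (hC.idRow_mem B (N + A.length)) (by
    intro e he e' he'
    have h2 := le_of_mem_idRow (show e' ∈ idRow (N + A.length) B by simpa using he')
    have h1 : e ∈ idRow N A ∨ e = a ∨ e = b := by
      simp only [List.append_nil, List.mem_append, List.mem_cons, List.not_mem_nil,
        or_false] at he
      tauto
    rcases h1 with h1 | rfl | rfl
    · simp only [idRow, List.mem_map] at h1
      obtain ⟨⟨d, i⟩, hd, rfl⟩ := h1
      have := (List.mem_zipIdx hd).2.1
      simp only
      omega
    · omega
    · omega)
  have hfix : ∀ x, x < N → idLbl N (A ++ B) x = x := fun x hx => idLbl_of_lt hx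
  have hmap := map_idLbl_idRow N (A ++ B)
  rw [idRow_append, List.map_append] at hmap
  obtain ⟨hA, hB⟩ := List.append_inj hmap (by simp)
  have hUfix : U.map (relabel (idLbl N (A ++ B))) = U :=
    map_relabel_eq_self fun e he => hfix _ (hN e (by simp [he]))
  have := hC.comp_ofLists_mem (idPairs N (A ++ B)) h hids (topRow_idPairs _ _)
    (by simp [botRow_idPairs, idRow_append]) ?_ (idLbl N (A ++ B)) ?_ ?_
  · rw [hUfix, List.map_append, List.map_append, hA, hB] at this
    simpa [relabel, hfix _ haN, hfix _ hbN] using this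
  · intro e he e' he'
    have h1 := hN e (by simp only [List.mem_cons]; tauto)
    have h2 : e' ∈ idRow N A ∨ e' = a ∨ e' = b ∨ e' ∈ idRow (N + A.length) B := by
      simp only [List.append_nil, List.mem_append, List.mem_cons, List.not_mem_nil,
        or_false] at he'
      tauto
    rcases h2 with h2 | rfl | rfl | h2
    · have := le_of_mem_idRow h2; omega
    · exact ha e he
    · exact hb e he
    · have := le_of_mem_idRow h2; omega
  · intro t ht
    rw [(idLbl_of_mem_idPairs ht).2]
    have : (t.1, t.2.1) ∈ topRow (idPairs N (A ++ B)) :=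
      List.mem_map.2 ⟨t, ht, rfl⟩
    rw [topRow_idPairs] at this
    exact hfix _ (hN (t.1, t.2.1) (by simp only [List.mem_cons, List.mem_append] at this ⊢; tauto))
  · intro e he
    have h1 : e ∈ U ∨ e = a ∨ e = b ∨ e ∈ idRow N (A ++ B) := by
      simp only [List.mem_append, List.mem_cons, List.not_mem_nil,
        or_false, idRow_append] at he ⊢
      tauto
    have hlow : e.2 < N → Joined (idPairs N (A ++ B)) e.2 (idLbl N (A ++ B) e.2) := fun h => by
      rw [hfix _ h]; exact Relation.EqvGen.refl _
    rcases h1 with h1 | rfl | rfl | h1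
    · exact hlow (hN e (by simp [h1]))
    · exact hlow haN
    · exact hlow hbN
    · exact joined_idPairs h1

/-- Contracting the two leftmost lower points. -/
lemma contract_mem (hC : IsCategory C) {U L : List Letter} {c : Bool} {x y : ℕ}
    (h : ofLists U ((c, x) :: (!c, y) :: L) ∈ C) :
    ofLists (U.map (relabel (subst x y))) (L.map (relabel (subst x y))) ∈ C := by
  obtain ⟨N, hN⟩ := exists_label_bound (U ++ ((c, x) :: (!c, y) :: L))
  have hxN : x < N := hN (c, x) (by simp)
  have hyN : y < N := hN (!c, y) (by simp)
  have hcap := hC.tensor_ofLists_mem (hC.invol_ofLists_mem (hC.pair_mem c N))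
    (hC.idRow_mem L (N + 1)) (by
      intro e he e' he'
      have h1 : e.2 = N := by
        simp only [List.cons_append, List.nil_append, List.mem_cons, List.not_mem_nil,
          or_false] at he
        rcases he with rfl | rfl <;> rfl
      have := le_of_mem_idRow (show e' ∈ idRow (N + 1) L by simpa using he')
      omega)
  set g : ℕ → ℕ := fun z => if z = N then y else idLbl (N + 1) L z with hg
  have hgN : ∀ z, z < N → g z = z := fun z hz => by
    simp only [hg, if_neg hz.ne]; exact idLbl_of_lt (by omega)
  have hgL : ∀ z, N + 1 ≤ z → g z = idLbl (N + 1) L z := fun z hz => by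
    simp only [hg, if_neg (show z ≠ N by omega)]
  have hL : (idRow (N + 1) L).map (relabel g) = L := by
    conv_rhs => rw [← map_idLbl_idRow (N + 1) L]
    exact map_relabel_congr fun e he => hgL _ (le_of_mem_idRow he)
  have hU : U.map (relabel g) = U := map_relabel_eq_self fun e he => hgN _ (hN e (by simp [he]))
  have := hC.comp_ofLists_mem ((c, x, N) :: (!c, y, N) :: idPairs (N + 1) L) h hcap
    (by simpa [topRow] using topRow_idPairs (N + 1) L)
    (by simpa [botRow] using botRow_idPairs (N + 1) L) ?_ (subst x y ∘ g) ?_ ?_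
  · rw [← map_relabel_map, ← map_relabel_map, hU] at this
    simpa [hL] using this
  · intro e he e' he'
    have h1 := hN e he
    have h2 : N ≤ e'.2 := by
      simp only [List.cons_append, List.nil_append, List.mem_cons, List.mem_append, or_self] at he'
      rcases he' with rfl | rfl | h2
      · exact le_rfl
      · exact le_rfl
      · have := le_of_mem_idRow h2; omega
    omega
  · intro t ht
    simp only [List.mem_cons] at ht
    rcases ht with rfl | rfl | ht
    · simp only [Function.comp_apply, hgN x hxN]; simp [hg, subst]
    · simp only [Function.comp_apply, hgN y hyN]; simp [hg]
    · obtain ⟨h1, h2⟩ := idLbl_of_mem_idPairs ht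
      have : (t.1, t.2.1) ∈ topRow (idPairs (N + 1) L) := List.mem_map.2 ⟨t, ht, rfl⟩
      rw [topRow_idPairs] at this
      have h3 : t.2.1 < N := hN (t.1, t.2.1) (by simp [this])
      simp only [Function.comp_apply, hgN _ h3, hgL _ h1, h2]
  · have hsub : ∀ z, Joined ((c, x, N) :: (!c, y, N) :: idPairs (N + 1) L) z (subst x y z) := by
      intro z
      unfold subst
      split_ifs with hz
      · rw [hz]
        exact (Relation.EqvGen.rel _ _ ⟨c, by simp⟩).trans _ N _
          (Relation.EqvGen.rel _ _ ⟨!c, by simp⟩).symm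
      · exact Relation.EqvGen.refl _
    intro e he
    refine Relation.EqvGen.trans _ (g e.2) _ ?_ (hsub _)
    simp only [List.nil_append, List.mem_append] at he
    rcases he with he | he
    · rw [hgN _ (hN e (by simp [he]))]; exact Relation.EqvGen.refl _
    · rw [hgL _ (le_of_mem_idRow he)]
      exact (joined_idPairs he).mono (by simp; tauto)

lemma sing_mem (hC : IsCategory C) (hs : singPair ∈ C) (c : Bool) {x y : ℕ} (hxy : x ≠ y) :
    ofLists [] [(c, x), (!c, y)] ∈ C := by
  cases c
  · obtain ⟨z, hz⟩ := exists_label_bound [(true, x), (true, y)]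
    have hx : x < z := hz (true, x) (by simp)
    have hy : y < z := hz (true, y) (by simp)
    have h1 : ofLists [] [(true, y), (false, x)] ∈ C := by rwa [← singPair_eq hxy.symm]
    have h2 := hC.insert_mem (U := []) (A := [(false, z)]) (B := [(true, z)])
      (hC.pair_mem false z) h1 (by simp; omega) (by simp; omega)
    have h3 := hC.contract_mem (U := []) (c := false) (x := z) (y := y)
      (L := [(false, x), (true, z)]) h2
    simpa [subst, hx.ne] using h3
  · rwa [Bool.not_true, ← singPair_eq hxy]

lemma sing_through_mem (hC : IsCategory C) (hs : singPair ∈ C) (c : Bool) {x y : ℕ}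
    (hxy : x ≠ y) : ofLists [(c, x)] [(c, y)] ∈ C := by
  obtain ⟨z, hz⟩ := exists_label_bound [(true, x), (true, y)]
  have hx : x < z := hz (true, x) (by simp)
  have hy : y < z := hz (true, y) (by simp)
  have h1 := hC.tensor_ofLists_mem (hC.id_mem c z) (hC.sing_mem hs (!c) hxy) (by simp; omega)
  have h2 := hC.contract_mem (U := [(c, z)]) (c := c) (x := z) (y := x) (L := [(c, y)])
    (by simpa using h1)
  simpa [subst, hy.ne] using h2

lemma insert_line_mem (hC : IsCategory C) {u v U L : List Letter} {a b : Letter}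
    (ih : ∀ U L, line U L = u ++ v → ofLists U L ∈ C) (h : line U L = u ++ a :: b :: v)
    (hs : ofLists [] [a, b] ∈ C) (hs' : ofLists [] [inv b, inv a] ∈ C)
    (ht : ofLists [inv a] [b] ∈ C)
    (ha : Fresh a.2 (u ++ v)) (hb : Fresh b.2 (u ++ v)) : ofLists U L ∈ C := by
  rcases List.append_eq_append_iff.1 h with ⟨w, rfl, rfl⟩ | ⟨w, hw, hv⟩
  · refine hC.insert_mem (ih _ _ (by simp [line])) hs ?_ ?_
    · simpa [and_assoc] using ha
    · simpa [and_assoc] using hb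
  · obtain _ | ⟨a', w⟩ := w
    · obtain rfl : L = a :: b :: v := by simpa using hv.symm
      have hU : u = flip U := by simpa using hw.symm
      subst hU
      refine hC.insert_mem (A := []) (ih _ _ (by simp [line])) hs ?_ ?_
      · simpa [and_assoc] using ha
      · simpa [and_assoc] using hb
    · have hv' : b :: v = w ++ L := (List.cons.inj hv).2
      obtain rfl : a = a' := (List.cons.inj hv).1
      clear hv h
      have hU : U = flip w ++ inv a :: flip u := by
        rw [← flip_flip U, hw]; simp
      subst hU
      obtain _ | ⟨b', w⟩ := w
      · obtain rfl : L = b :: v := by simpa using hv'.symm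
        refine hC.tensor_ofLists_mem ht (ih (flip u) v (by simp [line])) ?_
        intro e he e' he'
        have h1 : e = inv a ∨ e = b := by simpa using he
        have ha' : Fresh a.2 (flip u ++ v) := by simpa using ha
        have hb' : Fresh b.2 (flip u ++ v) := by simpa using hb
        rcases h1 with rfl | rfl
        · exact (ha' e' he').symm
        · exact (hb' e' he').symm
      · obtain rfl : v = w ++ L := (List.cons.inj hv').2
        obtain rfl : b = b' := (List.cons.inj hv').1
        have h1 := hC.invol_ofLists_mem (ih (flip w ++ flip u) L (by simp [line]))
        have := hC.insert_mem (a := inv b) (b := inv a) h1 hs'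
          (by simp at hb ⊢; tauto) (by simp at ha ⊢; tauto)
        simpa using hC.invol_ofLists_mem this

lemma good_mem (hC : IsCategory C) (hs : singPair ∈ C) {w : List Letter} (hw : Good w) :
    ∀ U L, line U L = w → ofLists U L ∈ C := by
  induction hw with
  | nil =>
    intro U L h
    obtain ⟨h1, rfl⟩ := List.append_eq_nil_iff.1 h
    have : U = [] := by rw [← flip_flip U, h1]; rfl
    subst this
    exact hC.empty_mem
  | pair u v c x _ hx ih =>
    intro U L h
    exact hC.insert_line_mem ih h (hC.pair_mem c x) (by simpa using hC.pair_mem c x)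
      (hC.id_mem _ x) hx hx
  | sing u v c x y _ hx hy hxy ih =>
    intro U L h
    exact hC.insert_line_mem ih h (hC.sing_mem hs c hxy)
      (by simpa using hC.sing_mem hs c hxy.symm) (hC.sing_through_mem hs _ hxy) hx hy

end IsCategory

lemma generated_singPair : generated {singPair} = goodSet := by
  ext p
  refine ⟨fun h => h _ isCategory_goodSet (by simpa using singPair_mem_goodSet), ?_⟩
  rintro ⟨U, L, rfl, h⟩ C hC hs
  exact hC.good_mem (hs rfl) h U L rfl

/-- The number of occurrences of the label `x` in the word `w`. -/
def mult (w : List Letter) (x : ℕ) : ℕ := w.countP fun e => decide (e.2 = x)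

/-- The number of letters of color `c` in `y` whose label occurs only once in `w`. -/
def singCount (w : List Letter) (c : Bool) (y : List Letter) : ℕ :=
  y.countP fun e => decide (mult w e.2 = 1 ∧ e.1 = c)

@[simp] lemma mult_append (u v : List Letter) (x : ℕ) :
    mult (u ++ v) x = mult u x + mult v x := by simp [mult]

lemma mult_cons (e : Letter) (v : List Letter) (x : ℕ) :
    mult (e :: v) x = mult v x + if e.2 = x then 1 else 0 := by simp [mult, List.countP_cons]

lemma mult_eq_zero {w : List Letter} {x : ℕ} : mult w x = 0 ↔ Fresh x w := by
  simp [mult, Fresh]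

@[simp] lemma singCount_nil (w : List Letter) (c : Bool) : singCount w c [] = 0 := rfl

@[simp] lemma singCount_append (w : List Letter) (c : Bool) (u v : List Letter) :
    singCount w c (u ++ v) = singCount w c u + singCount w c v := by simp [singCount]

lemma singCount_cons (w : List Letter) (c : Bool) (e : Letter) (v : List Letter) :
    singCount w c (e :: v) =
      singCount w c v + if mult w e.2 = 1 ∧ e.1 = c then 1 else 0 := by
  simp [singCount, List.countP_cons]

lemma singCount_congr {w w' y : List Letter} (h : ∀ e ∈ y, mult w e.2 = mult w' e.2) (c : Bool) :
    singCount w c y = singCount w' c y :=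
  List.countP_congr fun e he => by simp [h e he]

/-- The combinatorial description of the good words. -/
structure Balanced (w : List Letter) : Prop where
  pair : ∀ x s y t z, w = x ++ s :: (y ++ t :: z) → s.2 = t.2 →
    t.1 = !s.1 ∧ Fresh s.2 x ∧ Fresh s.2 y ∧ Fresh s.2 z ∧
      (∀ e ∈ y, Fresh e.2 x ∧ Fresh e.2 z) ∧ singCount w true y = singCount w false y
  total : singCount w true w = singCount w false w

lemma mult_insert {u v : List Letter} {a b : Letter} {x : ℕ} (ha : a.2 ≠ x) (hb : b.2 ≠ x) :
    mult (u ++ a :: b :: v) x = mult (u ++ v) x := by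
  simp [mult_cons, ha, hb]

lemma mult_insert_of_mem {u v : List Letter} {a b : Letter} (ha : Fresh a.2 (u ++ v))
    (hb : Fresh b.2 (u ++ v)) {e : Letter} (he : e ∈ u ++ v) :
    mult (u ++ a :: b :: v) e.2 = mult (u ++ v) e.2 :=
  mult_insert (ha e he).symm (hb e he).symm

lemma singCount_pair {u v : List Letter} {a b : Letter} (ha : Fresh a.2 (u ++ v))
    (hb : Fresh b.2 (u ++ v)) (hab : b.1 = !a.1) (y : List Letter) :
    singCount (u ++ a :: b :: v) true (a :: b :: y) =
        singCount (u ++ a :: b :: v) false (a :: b :: y) ↔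
      singCount (u ++ a :: b :: v) true y = singCount (u ++ a :: b :: v) false y := by
  have h1 := mult_eq_zero.2 ha
  have h2 := mult_eq_zero.2 hb
  rw [mult_append] at h1 h2
  have h3 : mult (u ++ a :: b :: v) a.2 = mult (u ++ a :: b :: v) b.2 := by
    simp only [mult_append, mult_cons, eq_comm (a := b.2) (b := a.2), if_true]
    omega
  simp only [singCount_cons, h3, hab]
  cases a.1 <;> by_cases h : mult (u ++ a :: b :: v) b.2 = 1 <;> simp [h]

lemma balanced_insert {u v : List Letter} {a b : Letter} (ha : Fresh a.2 (u ++ v))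
    (hb : Fresh b.2 (u ++ v)) (hab : b.1 = !a.1) (h : Balanced (u ++ v)) :
    Balanced (u ++ a :: b :: v) := by
  have hc : ∀ y : List Letter, (∀ e ∈ y, e ∈ u ++ v) → ∀ c,
      singCount (u ++ a :: b :: v) c y = singCount (u ++ v) c y := fun y hy =>
    singCount_congr fun e he => mult_insert_of_mem ha hb (hy e he)
  have ha' : ∀ e ∈ u ++ v, a.2 ≠ e.2 := fun e he => (ha e he).symm
  have hb' : ∀ e ∈ u ++ v, b.2 ≠ e.2 := fun e he => (hb e he).symm
  refine ⟨fun x s y t z he hst => ?_, ?_⟩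
  · rcases insert_two_split he with ⟨v', rfl, rfl⟩ | ⟨rfl, rfl, rfl⟩ | ⟨rfl, hY, rfl⟩ |
      ⟨u', rfl, hY⟩
    · obtain ⟨h1, h2, h3, h4, h5, h6⟩ := h.pair (u ++ v') s y t z (by simp) hst
      have hy : ∀ e ∈ y, e ∈ u ++ (v' ++ s :: (y ++ t :: z)) := fun e he => by simp [he]
      have hs : s ∈ u ++ (v' ++ s :: (y ++ t :: z)) := by simp
      rw [hc _ hy, hc _ hy]
      simp only [fresh_append, fresh_cons] at h2 h5 ⊢
      exact ⟨h1, ⟨h2.1, ha' s hs, hb' s hs, h2.2⟩, h3, h4, fun e he =>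
        ⟨⟨(h5 e he).1.1, ha' e (hy e he), hb' e (hy e he), (h5 e he).1.2⟩, (h5 e he).2⟩, h6⟩
    · exact absurd hst (hb' t (by simp))
    · rcases y with _ | ⟨b', y⟩
      · obtain rfl : b = t := (List.cons.inj hY).1.symm
        obtain rfl : z = v := (List.cons.inj hY).2
        rw [fresh_append] at ha
        exact ⟨hab, ha.1, fresh_nil _, ha.2, by simp, rfl⟩
      · obtain rfl : v = y ++ t :: z := ((List.cons.inj hY).2).symm
        exact absurd hst (ha' t (by simp))
    · rcases insert_two_split hY.symm with ⟨v', rfl, rfl⟩ | ⟨rfl, rfl, rfl⟩ | ⟨rfl, rfl, rfl⟩ |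
        ⟨u'', rfl, rfl⟩
      · obtain ⟨h1, h2, h3, h4, h5, h6⟩ := h.pair x s (u' ++ v') t z (by simp) hst
        have hy : ∀ e ∈ u' ++ v', e ∈ x ++ s :: u' ++ (v' ++ t :: z) := fun e he => by
          simp only [List.mem_append, List.mem_cons] at he ⊢; tauto
        have hs : s ∈ x ++ s :: u' ++ (v' ++ t :: z) := by simp
        have h7 := (singCount_pair ha hb hab (u' ++ v')).2 (by rwa [hc _ hy, hc _ hy])
        simp only [fresh_append, fresh_cons] at h3 ha hb ⊢
        refine ⟨h1, h2, ⟨h3.1, ha' s hs, hb' s hs, h3.2⟩, h4, fun e he => ?_, ?_⟩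
        · have : e ∈ u' ++ v' ∨ e = a ∨ e = b := by
            simp only [List.mem_append, List.mem_cons] at he ⊢; tauto
          rcases this with he | rfl | rfl
          · exact h5 e he
          · exact ⟨ha.1.1, ha.2.2.2⟩
          · exact ⟨hb.1.1, hb.2.2.2⟩
        · simp only [singCount_append, singCount_cons] at h7 ⊢
          omega
      · exact absurd hst.symm (hb' s (by simp))
      · exact absurd hst.symm (ha' s (by simp))
      · obtain ⟨h1, h2, h3, h4, h5, h6⟩ := h.pair x s y t (u'' ++ v) (by simp) hst
        have hy : ∀ e ∈ y, e ∈ x ++ s :: (y ++ t :: u'') ++ v := fun e he => by simp [he]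
        have hs : s ∈ x ++ s :: (y ++ t :: u'') ++ v := by simp
        rw [hc _ hy, hc _ hy]
        simp only [fresh_append, fresh_cons] at h4 h5 ⊢
        exact ⟨h1, h2, h3, ⟨h4.1, ha' s hs, hb' s hs, h4.2⟩, fun e he =>
          ⟨(h5 e he).1, (h5 e he).2.1, ha' e (hy e he), hb' e (hy e he), (h5 e he).2.2⟩, h6⟩
  · have h1 := (singCount_pair ha hb hab (u ++ v)).2 (by
      rw [hc _ fun _ => id, hc _ fun _ => id]; exact h.total)
    simp only [singCount_append, singCount_cons] at h1 ⊢
    omega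

lemma balanced_of_insert {u v : List Letter} {a b : Letter} (ha : Fresh a.2 (u ++ v))
    (hb : Fresh b.2 (u ++ v)) (hab : b.1 = !a.1) (h : Balanced (u ++ a :: b :: v)) :
    Balanced (u ++ v) := by
  have hc : ∀ y : List Letter, (∀ e ∈ y, e ∈ u ++ v) → ∀ c,
      singCount (u ++ a :: b :: v) c y = singCount (u ++ v) c y := fun y hy =>
    singCount_congr fun e he => mult_insert_of_mem ha hb (hy e he)
  refine ⟨fun x s y t z he hst => ?_, ?_⟩
  · have hy : ∀ e ∈ y, e ∈ u ++ v := fun e he' => by rw [he]; simp [he']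
    rw [← hc y hy, ← hc y hy]
    rcases List.append_eq_append_iff.1 he with ⟨w, rfl, rfl⟩ | ⟨w, rfl, hw⟩
    · obtain ⟨h1, h2, h3, h4, h5, h6⟩ := h.pair (u ++ a :: b :: w) s y t z (by simp) hst
      simp only [fresh_append, fresh_cons] at h2 h5 ⊢
      exact ⟨h1, ⟨h2.1, h2.2.2.2⟩, h3, h4,
        fun e he => ⟨⟨(h5 e he).1.1, (h5 e he).1.2.2.2⟩, (h5 e he).2⟩, h6⟩
    · rcases w with _ | ⟨s', w⟩
      · obtain rfl : v = s :: (y ++ t :: z) := by simpa using hw.symm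
        obtain ⟨h1, h2, h3, h4, h5, h6⟩ := h.pair (x ++ [a, b]) s y t z (by simp) hst
        rw [List.append_nil]
        simp only [fresh_append] at h2 h5
        exact ⟨h1, h2.1, h3, h4, fun e he => ⟨(h5 e he).1.1, (h5 e he).2⟩, by
          simpa only [List.append_nil] using h6⟩
      · obtain rfl : s = s' := (List.cons.inj hw).1
        have hw' : y ++ t :: z = w ++ v := (List.cons.inj hw).2
        rcases List.append_eq_append_iff.1 hw' with ⟨q, rfl, hq⟩ | ⟨q, rfl, rfl⟩
        · rcases q with _ | ⟨t', q⟩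
          · obtain rfl : v = t :: z := by simpa using hq.symm
            rw [List.append_nil] at *
            obtain ⟨h1, h2, h3, h4, h5, h6⟩ := h.pair x s (y ++ [a, b]) t z (by simp) hst
            refine ⟨h1, h2, (fresh_append _ _ _ |>.1 h3).1, h4,
              fun e he => h5 e (List.mem_append_left _ he), ?_⟩
            refine (singCount_pair ha hb hab y).1 ?_
            simp only [singCount_append, singCount_cons, singCount_nil] at h6 ⊢
            omega
          · obtain rfl : t = t' := (List.cons.inj hq).1
            obtain rfl : z = q ++ v := (List.cons.inj hq).2
            obtain ⟨h1, h2, h3, h4, h5, h6⟩ := h.pair x s y t (q ++ a :: b :: v) (by simp) hst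
            simp only [fresh_append, fresh_cons] at h4 h5 ⊢
            exact ⟨h1, h2, h3, ⟨h4.1, h4.2.2.2⟩,
              fun e he => ⟨(h5 e he).1, (h5 e he).2.1, (h5 e he).2.2.2.2⟩, h6⟩
        · obtain ⟨h1, h2, h3, h4, h5, h6⟩ := h.pair x s (w ++ a :: b :: q) t z (by simp) hst
          simp only [fresh_append, fresh_cons] at h3 ⊢
          refine ⟨h1, h2, ⟨h3.1, h3.2.2.2⟩, h4, fun e he => h5 e ?_, ?_⟩
          · simp only [List.mem_append, List.mem_cons] at he ⊢; tauto
          · rw [singCount_append, singCount_append]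
            have := (singCount_pair ha hb hab (w ++ q)).1 (by
              simp only [singCount_append, singCount_cons] at h6 ⊢
              omega)
            simpa only [singCount_append] using this
  · rw [← hc _ fun _ => id, ← hc _ fun _ => id]
    refine (singCount_pair ha hb hab (u ++ v)).1 ?_
    have h1 := h.total
    simp only [singCount_append, singCount_cons] at h1 ⊢
    omega

lemma Good.balanced {w : List Letter} (hw : Good w) : Balanced w := by
  induction hw with
  | nil => exact ⟨by simp, rfl⟩
  | pair u v c x _ hx ih => exact balanced_insert hx hx rfl ih
  | sing u v c x y _ hx hy _ ih => exact balanced_insert hx hy rfl ih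

lemma exists_split_of_not_nodup {w : List Letter} (h : ¬ (w.map Prod.snd).Nodup) :
    ∃ x s y t z, w = x ++ s :: (y ++ t :: z) ∧ s.2 = t.2 := by
  induction w with
  | nil => simp at h
  | cons e w ih =>
    by_cases he : e.2 ∈ w.map Prod.snd
    · obtain ⟨t, ht, hte⟩ := List.mem_map.1 he
      obtain ⟨y, z, rfl⟩ := List.append_of_mem ht
      exact ⟨[], e, y, t, z, rfl, hte.symm⟩
    · obtain ⟨x, s, y, t, z, rfl, hst⟩ := ih fun hn => h (List.nodup_cons.2 ⟨he, hn⟩)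
      exact ⟨e :: x, s, y, t, z, rfl, hst⟩

lemma exists_adjacent {y : List Letter} {s t : Letter} (hs : s ∈ y) (ht : t ∈ y)
    (h : t.1 = !s.1) : ∃ y₁ a b y₂, y = y₁ ++ a :: b :: y₂ ∧ b.1 = !a.1 := by
  induction y generalizing s t with
  | nil => simp at hs
  | cons a y ih =>
    rcases y with _ | ⟨b, y⟩
    · obtain rfl := List.mem_singleton.1 hs
      obtain rfl := List.mem_singleton.1 ht
      simp at h
    · by_cases hab : b.1 = !a.1
      · exact ⟨[], a, b, y, rfl, hab⟩
      · have hba : b.1 = a.1 := by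
          cases h1 : a.1 <;> cases h2 : b.1 <;> simp_all
        have key : ∃ s ∈ b :: y, ∃ t ∈ b :: y, t.1 = !s.1 := by
          rcases List.mem_cons.1 hs with rfl | hs' <;> rcases List.mem_cons.1 ht with rfl | ht'
          · simp at h
          · exact ⟨b, by simp, t, ht', by rw [h, hba]⟩
          · exact ⟨s, hs', b, by simp, by rw [hba, h]⟩
          · exact ⟨s, hs', t, ht', h⟩
        obtain ⟨s', hs', t', ht', h'⟩ := key
        obtain ⟨y₁, a', b', y₂, he, hc⟩ := ih hs' ht' h'
        exact ⟨a :: y₁, a', b', y₂, by rw [he]; rfl, hc⟩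

/-- A word that arises from a shorter word by inserting two adjacent letters of different
colors. -/
def Reducible (w : List Letter) : Prop :=
  ∃ u a b v, w = u ++ a :: b :: v ∧ b.1 = !a.1 ∧ Fresh a.2 (u ++ v) ∧ Fresh b.2 (u ++ v)

lemma fresh_of_nodup {y₁ y₂ : List Letter} {e : Letter}
    (h : ((y₁ ++ e :: y₂).map Prod.snd).Nodup) : Fresh e.2 (y₁ ++ y₂) := by
  rw [List.map_append, List.map_cons, List.nodup_middle, List.nodup_cons, ← List.map_append] at h
  exact fun e' he' heq => h.1 (heq ▸ List.mem_map_of_mem he')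

lemma reducible_of_nodup {x y z : List Letter} (hy : y ≠ []) (hn : (y.map Prod.snd).Nodup)
    (hf : ∀ e ∈ y, Fresh e.2 x ∧ Fresh e.2 z)
    (hs : singCount (x ++ (y ++ z)) true y = singCount (x ++ (y ++ z)) false y) :
    Reducible (x ++ (y ++ z)) := by
  have hm : ∀ e ∈ y, mult (x ++ (y ++ z)) e.2 = 1 := by
    intro e he
    obtain ⟨h1, h2⟩ := hf e he
    rw [mult_append, mult_append, mult_eq_zero.2 h1, mult_eq_zero.2 h2]
    obtain ⟨y₁, y₂, rfl⟩ := List.append_of_mem he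
    have h3 := (fresh_append _ _ _).1 (fresh_of_nodup hn)
    simp [mult_cons, mult_eq_zero.2 h3.1, mult_eq_zero.2 h3.2]
  have hopp : ∃ s ∈ y, ∃ t ∈ y, t.1 = !s.1 := by
    by_contra hcon
    push Not at hcon
    obtain ⟨e, y', rfl⟩ := List.exists_cons_of_ne_nil hy
    have h1 : ∀ t ∈ e :: y', t.1 = e.1 := fun t ht => by
      have := hcon e (by simp) t ht
      cases h1 : e.1 <;> cases h2 : t.1 <;> simp_all
    have h2 : 0 < singCount (x ++ (e :: y' ++ z)) e.1 (e :: y') := by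
      rw [singCount_cons, hm e (by simp)]; simp
    have h3 : singCount (x ++ (e :: y' ++ z)) (!e.1) (e :: y') = 0 := by
      refine List.countP_eq_zero.2 fun t ht => ?_
      simp [h1 t ht]
    cases h : e.1 <;> simp only [h, Bool.not_true, Bool.not_false] at h2 h3 <;> omega
  obtain ⟨s, hs, t, ht, hst⟩ := hopp
  obtain ⟨y₁, a, b, y₂, rfl, hab⟩ := exists_adjacent hs ht hst
  refine ⟨x ++ y₁, a, b, y₂ ++ z, by simp, hab, ?_, ?_⟩
  · have h1 := hf a (by simp)
    have h2 := fresh_of_nodup hn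
    simp only [fresh_append, fresh_cons] at h2 ⊢
    exact ⟨⟨h1.1, h2.1⟩, h2.2.2, h1.2⟩
  · have h1 := hf b (by simp)
    have h2 := fresh_of_nodup (y₁ := y₁ ++ [a]) (e := b) (y₂ := y₂) (by simpa using hn)
    simp only [fresh_append] at h2 ⊢
    exact ⟨⟨h1.1, h2.1.1⟩, h2.2, h1.2⟩

lemma Balanced.reducible_of_split {w : List Letter} (hw : Balanced w) (n : ℕ) :
    ∀ x s y t z, w = x ++ s :: (y ++ t :: z) → s.2 = t.2 → y.length = n → Reducible w := by
  induction n using Nat.strong_induction_on with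
  | _ n ih =>
    intro x s y t z he hst hlen
    obtain ⟨h1, h2, h3, h4, h5, h6⟩ := hw.pair x s y t z he hst
    by_cases hn : (y.map Prod.snd).Nodup
    · rcases y.eq_nil_or_concat with rfl | hy
      · refine ⟨x, s, t, z, by simpa using he, h1, by simp [h2, h4], by simp [← hst, h2, h4]⟩
      · have he' : w = (x ++ [s]) ++ (y ++ t :: z) := by simp [he]
        rw [he'] at h6 ⊢
        refine reducible_of_nodup (by grind) hn (fun e he => ?_) h6
        have := h5 e he
        have := h3 e he
        simp
        grind
    · obtain ⟨x', s', y', t', z', rfl, hst'⟩ := exists_split_of_not_nodup hn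
      refine ih y'.length (by simp at hlen; omega) (x ++ s :: x') s' y' t' (z' ++ t :: z)
        (by simp [he]) hst' rfl

lemma Balanced.reducible {w : List Letter} (hw : Balanced w) (h : w ≠ []) : Reducible w := by
  by_cases hn : (w.map Prod.snd).Nodup
  · simpa using reducible_of_nodup (x := []) (z := []) h hn (by simp) (by simpa using hw.total)
  · obtain ⟨x, s, y, t, z, he, hst⟩ := exists_split_of_not_nodup hn
    exact hw.reducible_of_split _ x s y t z he hst rfl

lemma Balanced.good (n : ℕ) : ∀ w : List Letter, w.length = n → Balanced w → Good w := by
  induction n using Nat.strong_induction_on with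
  | _ n ih =>
    intro w hlen hw
    by_cases h : w = []
    · rw [h]; exact Good.nil
    · obtain ⟨u, ⟨c, x⟩, ⟨d, y⟩, v, rfl, rfl, ha, hb⟩ := hw.reducible h
      have := ih (u ++ v).length (by simp at hlen ⊢; omega) _ rfl
        (balanced_of_insert ha hb rfl hw)
      by_cases hxy : x = y
      · subst hxy; exact Good.pair _ _ _ _ this ha
      · exact Good.sing _ _ _ _ _ this ha hb hxy

lemma good_iff_balanced {w : List Letter} : Good w ↔ Balanced w :=
  ⟨Good.balanced, Balanced.good _ w rfl⟩

lemma card_subtype_getElem (w : List Letter) (P : Letter → Prop) [DecidablePred P] :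
    Nat.card {m : Fin w.length // P w[m.1]} = w.countP fun e => decide (P e) := by
  rw [Nat.card_eq_fintype_card, Fintype.card_subtype]
  have h := Multiset.countP_map (fun m : Fin w.length => w[m.1]) Finset.univ.val P
  rw [Fin.univ_val_map, List.ofFn_getElem] at h
  rw [← Multiset.coe_countP, h]
  rfl

lemma card_between (x y z : List Letter) (s t : Letter) (P : Letter → Prop) [DecidablePred P]
    {w : List Letter} (hw : w = x ++ s :: (y ++ t :: z)) :
    Nat.card {m : Fin w.length // x.length < m.1 ∧ m.1 < x.length + 1 + y.length ∧ P w[m.1]} =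
      y.countP fun e => decide (P e) := by
  subst hw
  rw [← card_subtype_getElem]
  have key : ∀ (i : ℕ) (hi : i < y.length) (h : x.length + 1 + i < (x ++ s :: (y ++ t :: z)).length),
      (x ++ s :: (y ++ t :: z))[x.length + 1 + i] = y[i] := by
    intro i hi h
    rw [List.getElem_append_right (by omega)]
    simp [add_assoc, Nat.add_comm 1 i, hi]
  symm
  refine Nat.card_congr
    { toFun := fun m => ⟨⟨x.length + 1 + m.1.1, by simp; omega⟩, ?_⟩
      invFun := fun m => ⟨⟨m.1.1 - (x.length + 1), by have := m.2; omega⟩, ?_⟩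
      left_inv := ?_
      right_inv := ?_ }
  · refine ⟨by simp; omega, by simp, ?_⟩
    simp only [key _ m.1.2]
    exact m.2
  · have h := m.2
    have h' := key (m.1.1 - (x.length + 1)) (by omega) (by simp; omega)
    simp only [← h']
    convert h.2.2 using 2
    omega
  · intro m; ext; simp
  · intro m; ext; have := m.2.1; simp; omega

lemma split_at (w : List Letter) {i j : ℕ} (hij : i < j) (hj : j < w.length) :
    ∃ x y z, w = x ++ w[i] :: (y ++ w[j] :: z) ∧ x.length = i ∧ j = x.length + 1 + y.length := by
  refine ⟨w.take i, (w.drop (i + 1)).take (j - (i + 1)), w.drop (j + 1), ?_, by simp; omega,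
    by simp; omega⟩
  have h1 : w.drop j = w[j] :: w.drop (j + 1) := List.drop_eq_getElem_cons hj
  have h2 : w.drop (i + 1) = (w.drop (i + 1)).take (j - (i + 1)) ++ w.drop j := by
    conv_lhs => rw [← List.take_append_drop (j - (i + 1)) (w.drop (i + 1))]
    rw [List.drop_drop, show i + 1 + (j - (i + 1)) = j by omega]
  rw [← h1, ← h2, ← List.drop_eq_getElem_cons, List.take_append_drop]

lemma Good.mult_eq {w : List Letter} (hw : Good w) :
    ∀ e ∈ w, mult w e.2 = 1 ∨ mult w e.2 = 2 := by
  induction hw with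
  | nil => simp
  | pair u v c x _ hx ih =>
    intro e he
    have h1 : e ∈ u ++ v ∨ e.2 = x := by
      simp only [List.mem_append, List.mem_cons] at he ⊢
      rcases he with h | rfl | rfl | h <;> tauto
    rcases h1 with h1 | h1
    · rw [mult_insert_of_mem hx hx h1]
      exact ih e h1
    · rw [fresh_append] at hx
      simp [h1, mult_cons, mult_eq_zero.2 hx.1, mult_eq_zero.2 hx.2]
  | sing u v c x y _ hx hy hxy ih =>
    intro e he
    have h1 : e ∈ u ++ v ∨ e.2 = x ∨ e.2 = y := by
      simp only [List.mem_append, List.mem_cons] at he ⊢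
      rcases he with h | rfl | rfl | h <;> tauto
    rcases h1 with h1 | h1 | h1
    · rw [mult_insert_of_mem hx hy h1]
      exact ih e h1
    · rw [fresh_append] at hx
      simp [h1, mult_cons, mult_eq_zero.2 hx.1, mult_eq_zero.2 hx.2, hxy.symm]
    · rw [fresh_append] at hy
      simp [h1, mult_cons, mult_eq_zero.2 hy.1, mult_eq_zero.2 hy.2, hxy]

/-- The conditions describing the category, for a word. -/
structure Admissible (w : List Letter) : Prop where
  noncrossing : ∀ (i j m n : ℕ) (_ : i < j) (_ : j < m) (_ : m < n) (_ : n < w.length),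
    w[i].2 = w[m].2 → w[j].2 = w[n].2 → w[i].2 = w[j].2
  mult_eq : ∀ e ∈ w, mult w e.2 = 1 ∨ mult w e.2 = 2
  color : ∀ x s y t z, w = x ++ s :: (y ++ t :: z) → s.2 = t.2 → t.1 = !s.1
  between : ∀ x s y t z, w = x ++ s :: (y ++ t :: z) → s.2 = t.2 →
    singCount w true y = singCount w false y
  total : singCount w true w = singCount w false w

lemma getElem_of_eq_append {w l r : List Letter} {a : Letter} (h : w = l ++ a :: r) {i : ℕ}
    (hi : i = l.length) (hw : i < w.length) : w[i] = a := by
  subst h hi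
  simp

lemma Admissible.noncrossing_split {w : List Letter} (h : Admissible w) {a b c d : Letter}
    {v₁ v₂ v₃ v₄ v₅ : List Letter}
    (hw : w = v₁ ++ a :: (v₂ ++ b :: (v₃ ++ c :: (v₄ ++ d :: v₅)))) (hac : a.2 = c.2)
    (hbd : b.2 = d.2) : a.2 = b.2 := by
  have hlen : w.length = v₁.length + v₂.length + v₃.length + v₄.length + v₅.length + 4 := by
    simp [hw]; omega
  have ha := getElem_of_eq_append hw rfl (by omega)
  have hb := getElem_of_eq_append (l := v₁ ++ a :: v₂) (by simpa using hw)
    (i := v₁.length + v₂.length + 1) (by simp; omega) (by omega)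
  have hc := getElem_of_eq_append (l := v₁ ++ a :: (v₂ ++ b :: v₃)) (by simpa using hw)
    (i := v₁.length + v₂.length + v₃.length + 2) (by simp; omega) (by omega)
  have hd := getElem_of_eq_append (l := v₁ ++ a :: (v₂ ++ b :: (v₃ ++ c :: v₄)))
    (by simpa using hw) (i := v₁.length + v₂.length + v₃.length + v₄.length + 3)
    (by simp; omega) (by omega)
  have := h.noncrossing v₁.length (v₁.length + v₂.length + 1)
    (v₁.length + v₂.length + v₃.length + 2) (v₁.length + v₂.length + v₃.length + v₄.length + 3)
    (by omega) (by omega) (by omega) (by omega)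
  rw [ha, hb, hc, hd] at this
  exact this hac hbd

lemma Admissible.balanced {w : List Letter} (h : Admissible w) : Balanced w := by
  refine ⟨fun x s y t z he hst => ?_, h.total⟩
  have hm : mult w s.2 = 2 := by
    have h1 := h.mult_eq s (by simp [he])
    rw [he] at h1 ⊢
    simp only [mult_append, mult_cons, hst, if_true] at h1 ⊢
    omega
  have hf : Fresh s.2 x ∧ Fresh s.2 y ∧ Fresh s.2 z := by
    rw [he] at hm
    simp only [mult_append, mult_cons, hst, if_true] at hm
    simp only [← mult_eq_zero, hst]
    omega
  refine ⟨h.color x s y t z he hst, hf.1, hf.2.1, hf.2.2, fun e hey => ⟨?_, ?_⟩,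
    h.between x s y t z he hst⟩
  · intro e' he' heq
    obtain ⟨x₁, x₂, rfl⟩ := List.append_of_mem he'
    obtain ⟨y₁, y₂, rfl⟩ := List.append_of_mem hey
    exact hf.1 e' he' (h.noncrossing_split (by simpa using he) heq hst)
  · intro e' he' heq
    obtain ⟨z₁, z₂, rfl⟩ := List.append_of_mem he'
    obtain ⟨y₁, y₂, rfl⟩ := List.append_of_mem hey
    exact hf.2.1 e hey (h.noncrossing_split (by simpa using he) hst heq.symm).symm

lemma Good.admissible {w : List Letter} (hw : Good w) : Admissible w := by
  refine ⟨fun i j m n hij hjm hmn hn h1 h2 => ?_, hw.mult_eq,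
    fun x s y t z he hst => (hw.balanced.pair x s y t z he hst).1,
    fun x s y t z he hst => (hw.balanced.pair x s y t z he hst).2.2.2.2.2, hw.balanced.total⟩
  obtain ⟨x, y, z, he, hx, hy⟩ := split_at w (hij.trans hjm) (hmn.trans hn)
  have h5 := (hw.balanced.pair x _ y _ z he h1).2.2.2.2.1
  generalize hs : w[i] = s at *
  generalize ht : w[m] = t at *
  subst he
  have hjy : (x ++ s :: (y ++ t :: z))[j] ∈ y := by
    rw [List.getElem_append_right (by omega), List.getElem_cons, dif_neg (by omega),
      List.getElem_append_left (by omega)]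
    exact List.getElem_mem _
  have hnz : (x ++ s :: (y ++ t :: z))[n] ∈ z := by
    rw [List.getElem_append_right (by omega), List.getElem_cons, dif_neg (by omega),
      List.getElem_append_right (by omega), List.getElem_cons, dif_neg (by omega)]
    exact List.getElem_mem _
  exact absurd h2.symm ((h5 _ hjy).2 _ hnz)

lemma good_iff_admissible {w : List Letter} : Good w ↔ Admissible w :=
  ⟨Good.admissible, fun h => good_iff_balanced.2 h.balanced⟩

/-- The point of `p` at a given position on the line. -/
def linePt (p : TCP) (j : Fin (p.k + p.l)) : Fin p.k ⊕ Fin p.l :=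
  if hj : j.1 < p.k then Sum.inl ⟨p.k - 1 - j.1, by omega⟩
  else Sum.inr ⟨j.1 - p.k, by have := j.2; omega⟩

lemma linePos_linePt (p : TCP) (j : Fin (p.k + p.l)) : linePos p (linePt p j) = j.1 := by
  unfold linePt linePos
  split_ifs with h <;> simp <;> omega

lemma exists_linePt (p : TCP) (x : Fin p.k ⊕ Fin p.l) : ∃ j, linePt p j = x := by
  rcases x with i | j
  · refine ⟨⟨p.k - 1 - i.1, by omega⟩, ?_⟩
    rw [linePt, dif_pos (show p.k - 1 - i.1 < p.k by omega)]
    congr 1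
    ext
    simp only
    omega
  · refine ⟨⟨p.k + j.1, by omega⟩, ?_⟩
    rw [linePt, dif_neg (show ¬ p.k + j.1 < p.k by omega)]
    simp

lemma noncrossing_iff (p : TCP) : Noncrossing p ↔
    ∀ a b x y : Fin (p.k + p.l), a.1 < b.1 → b.1 < x.1 → x.1 < y.1 →
      p.rel.r (linePt p a) (linePt p x) → p.rel.r (linePt p b) (linePt p y) →
      p.rel.r (linePt p a) (linePt p b) := by
  refine ⟨fun h a b x y h1 h2 h3 => h _ _ _ _ (by simpa only [linePos_linePt])
    (by simpa only [linePos_linePt]) (by simpa only [linePos_linePt]), fun h a b x y => ?_⟩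
  obtain ⟨a, rfl⟩ := exists_linePt p a
  obtain ⟨b, rfl⟩ := exists_linePt p b
  obtain ⟨x, rfl⟩ := exists_linePt p x
  obtain ⟨y, rfl⟩ := exists_linePt p y
  simp only [linePos_linePt]
  exact h a b x y

lemma getElem_line_of_lt {U : List Letter} (L : List Letter) {j : ℕ} (h : j < U.length)
    (hj : j < (line U L).length) : (line U L)[j] = inv U[U.length - 1 - j] := by
  simp only [line, List.getElem_append_left (show j < (flip U).length by simpa using h)]
  simp [flip]

lemma getElem_line_of_le {U L : List Letter} {j : ℕ} (h : U.length ≤ j)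
    (hj : j < (line U L).length) :
    (line U L)[j] = L[j - U.length]'(by simp [line] at hj; omega) := by
  simp only [line, List.getElem_append_right (show (flip U).length ≤ j by simpa using h)]
  simp

lemma linePt_ofLists (U L : List Letter) (j : Fin ((ofLists U L).k + (ofLists U L).l))
    (hj : j.1 < (line U L).length) :
    lbl U L (linePt (ofLists U L) j) = (line U L)[j.1].2 := by
  unfold linePt
  split_ifs with h
  · exact (congrArg Prod.snd (getElem_line_of_lt L h hj)).symm
  · exact (congrArg Prod.snd (getElem_line_of_le (not_lt.1 h) hj)).symm

lemma length_line (U L : List Letter) : (line U L).length = (ofLists U L).k + (ofLists U L).l := by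
  simp [line, ofLists]

lemma toLine_ofLists (U L : List Letter) : toLine (ofLists U L) = ofLists [] (line U L) := by
  refine eq_ofLists rfl (length_line U L).symm (fun i => i.elim0) ?_
    (Sum.elim (fun i => i.elim0) fun j => lbl U L (linePt (ofLists U L) j)) (fun i => i.elim0)
    (fun j => linePt_ofLists U L j _) ?_
  · intro j
    simp only [toLine]
    split_ifs with h
    · exact (congrArg Prod.fst (getElem_line_of_lt L h _)).symm
    · exact (congrArg Prod.fst (getElem_line_of_le (not_lt.1 h) _)).symm
  · rintro (x | x) (y | y)
    · exact x.elim0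
    · exact x.elim0
    · exact y.elim0
    · exact Iff.rfl

lemma noncrossing_ofLists (U L : List Letter) : Noncrossing (ofLists U L) ↔
    ∀ (i j m n : ℕ) (_ : i < j) (_ : j < m) (_ : m < n) (_ : n < (line U L).length),
      (line U L)[i].2 = (line U L)[m].2 → (line U L)[j].2 = (line U L)[n].2 →
      (line U L)[i].2 = (line U L)[j].2 := by
  have hlen := length_line U L
  have hr : ∀ a b : Fin ((ofLists U L).k + (ofLists U L).l),
      (ofLists U L).rel.r (linePt (ofLists U L) a) (linePt (ofLists U L) b) ↔
        ((line U L)[a.1]'(by omega)).2 = ((line U L)[b.1]'(by omega)).2 := by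
    intro a b
    rw [← linePt_ofLists, ← linePt_ofLists]
    exact Iff.rfl
  simp only [noncrossing_iff, hr]
  refine ⟨fun h i j m n h1 h2 h3 h4 => ?_, fun h a b x y h1 h2 h3 =>
    h a.1 b.1 x.1 y.1 h1 h2 h3 (by omega)⟩
  exact h ⟨i, by omega⟩ ⟨j, by omega⟩ ⟨m, by omega⟩ ⟨n, by omega⟩ h1 h2 h3

/-- The block and color conditions describing the category, for a partition without upper
points. -/
def LineCondition (q : TCP) : Prop :=
  (∀ x : Fin q.k ⊕ Fin q.l, blockSize q x = 1 ∨ blockSize q x = 2) ∧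
  (∀ j j' : Fin q.l, q.rel.r (Sum.inr j) (Sum.inr j') → j ≠ j' →
    q.lowColor j = !(q.lowColor j')) ∧
  (∀ j j' : Fin q.l, q.rel.r (Sum.inr j) (Sum.inr j') → j.1 < j'.1 →
    Nat.card {m : Fin q.l // j.1 < m.1 ∧ m.1 < j'.1 ∧
        blockSize q (Sum.inr m) = 1 ∧ q.lowColor m = white} =
    Nat.card {m : Fin q.l // j.1 < m.1 ∧ m.1 < j'.1 ∧
        blockSize q (Sum.inr m) = 1 ∧ q.lowColor m = black}) ∧
  Nat.card {j : Fin q.l // blockSize q (Sum.inr j) = 1 ∧ q.lowColor j = white} =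
    Nat.card {j : Fin q.l // blockSize q (Sum.inr j) = 1 ∧ q.lowColor j = black}

lemma blockSize_ofLists (w : List Letter) (m : Fin w.length) :
    blockSize (ofLists [] w) (Sum.inr m) = mult w w[m.1].2 := by
  rw [mult, ← card_subtype_getElem w fun e => e.2 = w[m.1].2]
  refine Nat.card_congr (Equiv.subtypeEquiv (Equiv.emptySum (Fin 0) (Fin w.length)) ?_)
  rintro (y | y)
  · exact y.elim0
  · exact eq_comm

lemma lineCondition_ofLists (w : List Letter) : LineCondition (ofLists [] w) ↔
    (∀ m : Fin w.length, mult w w[m.1].2 = 1 ∨ mult w w[m.1].2 = 2) ∧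
    (∀ j j' : Fin w.length, w[j.1].2 = w[j'.1].2 → j ≠ j' → w[j.1].1 = !w[j'.1].1) ∧
    (∀ j j' : Fin w.length, w[j.1].2 = w[j'.1].2 → j.1 < j'.1 →
      Nat.card {m : Fin w.length // j.1 < m.1 ∧ m.1 < j'.1 ∧
          mult w w[m.1].2 = 1 ∧ w[m.1].1 = true} =
        Nat.card {m : Fin w.length // j.1 < m.1 ∧ m.1 < j'.1 ∧
          mult w w[m.1].2 = 1 ∧ w[m.1].1 = false}) ∧
    Nat.card {m : Fin w.length // mult w w[m.1].2 = 1 ∧ w[m.1].1 = true} =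
      Nat.card {m : Fin w.length // mult w w[m.1].2 = 1 ∧ w[m.1].1 = false} := by
  simp only [← blockSize_ofLists]
  refine and_congr ⟨fun h m => h (Sum.inr m), fun h x => ?_⟩ Iff.rfl
  rcases x with x | x
  · exact x.elim0
  · exact h x

lemma admissible_iff (w : List Letter) : Admissible w ↔
    (∀ (i j m n : ℕ) (_ : i < j) (_ : j < m) (_ : m < n) (_ : n < w.length),
      w[i].2 = w[m].2 → w[j].2 = w[n].2 → w[i].2 = w[j].2) ∧ LineCondition (ofLists [] w) := by
  rw [lineCondition_ofLists, card_subtype_getElem w fun e => mult w e.2 = 1 ∧ e.1 = true,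
    card_subtype_getElem w fun e => mult w e.2 = 1 ∧ e.1 = false]
  constructor
  · intro h
    refine ⟨h.noncrossing, fun m => h.mult_eq _ (List.getElem_mem _), ?_, ?_, h.total⟩
    · intro j j' hjj hne
      rcases lt_or_gt_of_ne (Fin.val_ne_of_ne hne) with hlt | hlt
      · obtain ⟨x, y, z, he, -⟩ := split_at w hlt j'.2
        rw [h.color _ _ _ _ _ he hjj, Bool.not_not]
      · obtain ⟨x, y, z, he, -⟩ := split_at w hlt j.2
        exact h.color _ _ _ _ _ he hjj.symm
    · intro j j' hjj hlt
      obtain ⟨x, y, z, he, hx, hy⟩ := split_at w hlt j'.2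
      have h1 := card_between x y z _ _ (fun e => mult w e.2 = 1 ∧ e.1 = true) he
      have h2 := card_between x y z _ _ (fun e => mult w e.2 = 1 ∧ e.1 = false) he
      rw [← hy, hx] at h1 h2
      rw [h1, h2]
      exact h.between _ _ _ _ _ he hjj
  · rintro ⟨h1, h2, h3, h4, h5⟩
    have key : ∀ x s y t z, w = x ++ s :: (y ++ t :: z) →
        ∃ j j' : Fin w.length, j.1 = x.length ∧ j'.1 = x.length + 1 + y.length ∧
          w[j.1] = s ∧ w[j'.1] = t := by
      intro x s y t z he
      have hlen : w.length = x.length + y.length + z.length + 2 := by simp [he]; omega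
      exact ⟨⟨x.length, by omega⟩, ⟨x.length + 1 + y.length, by omega⟩, rfl, rfl,
        getElem_of_eq_append he rfl _,
        getElem_of_eq_append (l := x ++ s :: y) (by simpa using he) (by simp; omega) _⟩
    refine ⟨h1, fun e he => ?_, fun x s y t z he hst => ?_, fun x s y t z he hst => ?_, h5⟩
    · obtain ⟨m, hm, rfl⟩ := List.getElem_of_mem he
      exact h2 ⟨m, hm⟩
    · obtain ⟨j, j', hj, hj', rfl, rfl⟩ := key x s y t z he
      exact h3 j' j hst.symm fun h => by subst h; omega
    · obtain ⟨j, j', hj, hj', hs, ht⟩ := key x s y t z he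
      have := h4 j j' (by rw [hs, ht, hst]) (by omega)
      rw [hj, hj'] at this
      rw [card_between x y z s t (fun e => mult w e.2 = 1 ∧ e.1 = true) he,
        card_between x y z s t (fun e => mult w e.2 = 1 ∧ e.1 = false) he] at this
      exact this

lemma good_line_iff (U L : List Letter) : Good (line U L) ↔
    Noncrossing (ofLists U L) ∧ LineCondition (toLine (ofLists U L)) := by
  rw [good_iff_admissible, admissible_iff, noncrossing_ofLists, toLine_ofLists]

/-- Description of the category `⟨∘⊗•⟩`. -/
theorem stmt_16 :
    generated {singPair} =
      {p : TCP | Noncrossing p ∧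
        (∀ x : Fin (toLine p).k ⊕ Fin (toLine p).l,
          blockSize (toLine p) x = 1 ∨ blockSize (toLine p) x = 2) ∧
        (∀ j j' : Fin (toLine p).l, (toLine p).rel.r (Sum.inr j) (Sum.inr j') → j ≠ j' →
          (toLine p).lowColor j = !((toLine p).lowColor j')) ∧
        (∀ j j' : Fin (toLine p).l, (toLine p).rel.r (Sum.inr j) (Sum.inr j') → j.1 < j'.1 →
          Nat.card {m : Fin (toLine p).l // j.1 < m.1 ∧ m.1 < j'.1 ∧
              blockSize (toLine p) (Sum.inr m) = 1 ∧ (toLine p).lowColor m = white} =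
          Nat.card {m : Fin (toLine p).l // j.1 < m.1 ∧ m.1 < j'.1 ∧
              blockSize (toLine p) (Sum.inr m) = 1 ∧ (toLine p).lowColor m = black}) ∧
        Nat.card {j : Fin (toLine p).l //
            blockSize (toLine p) (Sum.inr j) = 1 ∧ (toLine p).lowColor j = white} =
          Nat.card {j : Fin (toLine p).l //
            blockSize (toLine p) (Sum.inr j) = 1 ∧ (toLine p).lowColor j = black}} := by
  rw [generated_singPair]
  ext p
  constructor
  · rintro ⟨U, L, rfl, h⟩
    exact (good_line_iff U L).1 h
  · intro h
    obtain ⟨U, L, rfl⟩ := exists_eq_ofLists p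
    exact ⟨U, L, rfl, (good_line_iff U L).2 h⟩

end CTCP
end
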